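/- arXiv:1507.02861 — 2 statements merged into one kernel-verified Lean document; each statement's English description precedes it below -/
import Mathlib

section
/- Let g be a transcendental entire function of order ρ(g) < 1/2 and let f = −i·g/g′. Then every trajectory z(t) of ż = f(z) satisfies log|g(z(t))| = constant along the trajectory; consequently, since min{|g(z)| : |z| = r} is unbounded as r → ∞ (by the cos πρ theorem), every trajectory of ż = f(z) is bounded. -/
open Set Filter Topology MeasureTheory in
/-- Differentiation under the integral sign over a compact interval. -/
theorem hasDerivAt_intervalIntegral_of_continuous {F F' : ℝ → ℝ → ℝ} (a b : ℝ)
    (hF : ∀ s, Continuous (F s)) (hF' : Continuous (Function.uncurry F'))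
    (hd : ∀ s θ, HasDerivAt (fun x => F x θ) (F' s θ) s) (s : ℝ) :
    HasDerivAt (fun x => ∫ θ in a..b, F x θ) (∫ θ in a..b, F' s θ) s := by
  obtain ⟨C, hC⟩ := ((isCompact_Icc (a := s - 1) (b := s + 1)).prod
    (isCompact_uIcc (a := a) (b := b))).exists_bound_of_continuousOn hF'.continuousOn
  refine (intervalIntegral.hasDerivAt_integral_of_dominated_loc_of_deriv_le
    (bound := fun _ => C) (s := Icc (s - 1) (s + 1)) (F := F) (F' := F')
    (Icc_mem_nhds (by linarith) (by linarith)) ?_ ((hF s).intervalIntegrable _ _) ?_ ?_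
    intervalIntegrable_const ?_).2
  · exact Eventually.of_forall fun x => (hF x).aestronglyMeasurable
  · exact (hF'.comp (Continuous.prodMk_right s)).aestronglyMeasurable
  · exact Eventually.of_forall fun θ hθ x hx => hC (x, θ) ⟨hx, uIoc_subset_uIcc hθ⟩
  · exact Eventually.of_forall fun θ _ x _ => hd x θ

/-- A perturbed Wirtinger inequality: the boundary term measures the failure of `f` to vanish at
the end points. -/
theorem wirtinger_two_pi {f f' : ℝ → ℝ} (hf : ∀ x, HasDerivAt f (f' x) x) (hf' : Continuous f')
    {μ : ℝ} (hμ0 : 0 < μ) (hμ : μ < 1 / 2) (a : ℝ) (hper : f (a + 2 * Real.pi) = f a) :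
    μ ^ 2 * (∫ x in a..a + 2 * Real.pi, f x ^ 2) - 2 * μ * Real.tan (μ * Real.pi) * f a ^ 2
      ≤ ∫ x in a..a + 2 * Real.pi, f' x ^ 2 := by
  have hpi := Real.pi_pos
  have hfc : Continuous f := continuous_iff_continuousAt.2 fun x => (hf x).continuousAt
  have hcos : ∀ x ∈ Set.uIcc a (a + 2 * Real.pi), Real.cos (μ * (x - a - Real.pi)) ≠ 0 := by
    intro x hx
    rw [Set.uIcc_of_le (by linarith)] at hx
    refine (Real.cos_pos_of_mem_Ioo ⟨?_, ?_⟩).ne' <;> nlinarith [hx.1, hx.2]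
  set q : ℝ → ℝ := fun x => μ * Real.tan (μ * (x - a - Real.pi)) with hq
  have hqd : ∀ x ∈ Set.uIcc a (a + 2 * Real.pi), HasDerivAt q (μ ^ 2 + q x ^ 2) x := by
    intro x hx
    have h1 : HasDerivAt (fun x => μ * (x - a - Real.pi)) (μ * 1) x :=
      (((hasDerivAt_id x).sub_const a).sub_const Real.pi).const_mul μ
    have h2 := ((Real.hasDerivAt_tan (hcos x hx)).comp x h1).const_mul μ
    refine h2.congr_deriv ?_
    simp only [hq, Real.tan_eq_sin_div_cos]
    have h3 := hcos x hx
    field_simp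
    linarith [Real.sin_sq_add_cos_sq (μ * (x - a - Real.pi))]
  have hqc : ContinuousOn q (Set.uIcc a (a + 2 * Real.pi)) := fun x hx =>
    (hqd x hx).continuousAt.continuousWithinAt
  have hFTC := intervalIntegral.integral_eq_sub_of_hasDerivAt
    (f := fun x => f x ^ 2 * q x)
    (f' := fun x => 2 * f x * f' x * q x + f x ^ 2 * (μ ^ 2 + q x ^ 2))
    (a := a) (b := a + 2 * Real.pi)
    (fun x hx => by
      refine (((hf x).pow 2).mul (hqd x hx)).congr_deriv ?_
      simp)
    (ContinuousOn.intervalIntegrable (by fun_prop))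
  have hend : f (a + 2 * Real.pi) ^ 2 * q (a + 2 * Real.pi) - f a ^ 2 * q a
      = 2 * μ * Real.tan (μ * Real.pi) * f a ^ 2 := by
    have e1 : μ * (a + 2 * Real.pi - a - Real.pi) = μ * Real.pi := by ring
    have e2 : μ * (a - a - Real.pi) = -(μ * Real.pi) := by ring
    simp only [hq, hper, e1, e2, Real.tan_neg]
    ring
  rw [hend] at hFTC
  rw [← hFTC, ← intervalIntegral.integral_const_mul, ← intervalIntegral.integral_sub
    (Continuous.intervalIntegrable (by fun_prop) _ _)
    (ContinuousOn.intervalIntegrable (by fun_prop))]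
  refine intervalIntegral.integral_mono_on (by linarith)
    (ContinuousOn.intervalIntegrable (by fun_prop))
    (Continuous.intervalIntegrable (by fun_prop) _ _) fun x _ => ?_
  nlinarith [sq_nonneg (f' x + f x * q x), sq_nonneg (f' x - f x * q x)]

theorem monotoneOn_Ici_of_hasDerivAt_nonneg {f f' : ℝ → ℝ} {a : ℝ}
    (hf : ∀ x, HasDerivAt f (f' x) x) (h : ∀ x, a ≤ x → 0 ≤ f' x) :
    MonotoneOn f (Set.Ici a) := by
  refine monotoneOn_of_deriv_nonneg (convex_Ici a)
    (fun x _ => (hf x).continuousAt.continuousWithinAt)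
    (fun x _ => (hf x).differentiableAt.differentiableWithinAt) fun x hx => ?_
  rw [interior_Ici] at hx
  rw [(hf x).deriv]
  exact h x (le_of_lt hx)

/-- A convex function on the line which is bounded near `-∞`, not constant, and satisfies the
differential inequalities of Carleman's method grows exponentially. -/
theorem exp_growth_of_convex {J J' J'' : ℝ → ℝ} (h1 : ∀ s, HasDerivAt J (J' s) s)
    (h2 : ∀ s, HasDerivAt J' (J'' s) s) (hconv : ∀ s, 0 ≤ J'' s)
    {B : ℝ} (hB : ∀ s ≤ 0, J s ≤ B) (hne : ∃ s, J' s ≠ 0) {μ C s₀ : ℝ} (hμ : 0 < μ) (hC : 0 ≤ C)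
    (hJ : ∀ s, s₀ ≤ s → 2 * μ ^ 2 * J s - 2 * C ≤ J'' s)
    (hJ' : ∀ s, s₀ ≤ s → 2 * μ * J' s - 2 * C ≤ J'' s) :
    ∃ c > 0, ∃ D, ∃ s₁, ∀ s, s₁ ≤ s → c * Real.exp (2 * μ * s) - D ≤ J s := by
  have hmono : Monotone J' := monotone_of_hasDerivAt_nonneg h2 hconv
  have htan : ∀ s t, J t + J' t * (s - t) ≤ J s := by
    intro s t
    have hd : ∀ x, HasDerivAt (fun x => J x - J' t * x) (J' x - J' t * 1) x := fun x =>
      (h1 x).sub ((hasDerivAt_id x).const_mul _)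
    rcases le_total t s with hts | hst
    · have := monotoneOn_Ici_of_hasDerivAt_nonneg (a := t) hd
        (fun x hx => by linarith [hmono hx]) (Set.mem_Ici.2 le_rfl) hts hts
      simp only at this
      linarith
    · have hd' : ∀ x, HasDerivAt (fun x => J (-x) + J' t * x) (-J' (-x) + J' t * 1) x := fun x =>
        (((h1 (-x)).comp x (hasDerivAt_neg x)).congr_deriv (by ring)).add
          ((hasDerivAt_id x).const_mul _)
      have := monotoneOn_Ici_of_hasDerivAt_nonneg (a := -t) hd'
        (fun x hx => by linarith [hmono (show -x ≤ t by linarith)])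
        (Set.mem_Ici.2 le_rfl) (Set.mem_Ici.2 (neg_le_neg hst)) (neg_le_neg hst)
      simp only [neg_neg] at this
      linarith
  have hnonneg : ∀ t, 0 ≤ J' t := by
    intro t
    by_contra! ht
    have hs : ∀ s ≤ 0, J t + J' t * (s - t) ≤ B := fun s hs => (htan s t).trans (hB s hs)
    set s := min 0 (t + (B + 1 - J t) / J' t)
    have h3 : (t + (B + 1 - J t) / J' t - t) * J' t = B + 1 - J t := by
      rw [add_sub_cancel_left, div_mul_cancel₀ _ ht.ne]
    have h4 := hs s (min_le_left _ _)
    have h5 : s ≤ t + (B + 1 - J t) / J' t := min_le_right _ _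
    nlinarith
  obtain ⟨t, ht⟩ := hne
  have htpos : 0 < J' t := lt_of_le_of_ne (hnonneg t) ht.symm
  obtain ⟨s₂, hs₂0, hs₂⟩ : ∃ s₂, s₀ ≤ s₂ ∧ ∀ s, s₂ ≤ s → 1 ≤ J'' s := by
    set L := (2 * C + 1) / (2 * μ ^ 2)
    refine ⟨max s₀ (t + (L - J t) / J' t), le_max_left _ _, fun s hs => ?_⟩
    have h3 : (t + (L - J t) / J' t - t) * J' t = L - J t := by
      rw [add_sub_cancel_left, div_mul_cancel₀ _ ht]
    have h4 : t + (L - J t) / J' t ≤ s := (le_max_right _ _).trans hs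
    have h5 : L ≤ J s := by nlinarith [htan s t]
    have h6 : L * (2 * μ ^ 2) = 2 * C + 1 := div_mul_cancel₀ _ (by positivity)
    nlinarith [hJ s ((le_max_left _ _).trans hs), mul_le_mul_of_nonneg_right h5
      (show 0 ≤ 2 * μ ^ 2 by positivity)]
  obtain ⟨s₃, hs₃0, hs₃⟩ : ∃ s₃, s₂ ≤ s₃ ∧ C / μ + 1 ≤ J' s₃ := by
    refine ⟨s₂ + (C / μ + 1), by linarith [div_nonneg hC hμ.le], ?_⟩
    have hd : ∀ x, HasDerivAt (fun x => J' x - x) (J'' x - 1) x := fun x =>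
      (h2 x).sub (hasDerivAt_id x)
    have hle : s₂ ≤ s₂ + (C / μ + 1) := by linarith [div_nonneg hC hμ.le]
    have := monotoneOn_Ici_of_hasDerivAt_nonneg (a := s₂) hd
      (fun x hx => by linarith [hs₂ x hx]) (Set.mem_Ici.2 le_rfl) hle hle
    simp only at this
    linarith [hnonneg s₂]
  have hexp : ∀ x, HasDerivAt (fun x => Real.exp (-(2 * μ) * x))
      (Real.exp (-(2 * μ) * x) * (-(2 * μ) * 1)) x := fun x =>
    ((hasDerivAt_id x).const_mul _).exp
  have hexp' : ∀ x, HasDerivAt (fun x => Real.exp (2 * μ * (x - s₃)))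
      (Real.exp (2 * μ * (x - s₃)) * (2 * μ * 1)) x := fun x =>
    (((hasDerivAt_id x).sub_const s₃).const_mul _).exp
  have hJ'exp : ∀ s, s₃ ≤ s → Real.exp (2 * μ * (s - s₃)) ≤ J' s := by
    intro s hs
    have hd : ∀ x, HasDerivAt (fun x => (J' x - C / μ) * Real.exp (-(2 * μ) * x))
        (J'' x * Real.exp (-(2 * μ) * x)
          + (J' x - C / μ) * (Real.exp (-(2 * μ) * x) * (-(2 * μ) * 1))) x := fun x =>
      ((h2 x).sub_const _).mul (hexp x)
    have := monotoneOn_Ici_of_hasDerivAt_nonneg (a := s₃) hd (fun x hx => by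
        have h3 := hJ' x (by linarith)
        have h4 : C / μ * μ = C := div_mul_cancel₀ _ hμ.ne'
        have h5 : 0 ≤ J'' x - 2 * μ * (J' x - C / μ) := by nlinarith
        have := mul_nonneg h5 (Real.exp_pos (-(2 * μ) * x)).le
        linarith) (Set.mem_Ici.2 le_rfl) hs hs
    simp only at this
    have h6 : Real.exp (-(2 * μ) * s₃) ≤ (J' s - C / μ) * Real.exp (-(2 * μ) * s) := by
      refine le_trans ?_ this
      exact le_mul_of_one_le_left (Real.exp_pos _).le (by linarith)
    have h7 := mul_le_mul_of_nonneg_right h6 (Real.exp_pos (2 * μ * s)).le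
    rw [mul_assoc (_ - _), ← Real.exp_add, ← Real.exp_add] at h7
    have e1 : -(2 * μ) * s₃ + 2 * μ * s = 2 * μ * (s - s₃) := by ring
    have e2 : -(2 * μ) * s + 2 * μ * s = 0 := by ring
    rw [e1, e2, Real.exp_zero, mul_one] at h7
    linarith [div_nonneg hC hμ.le]
  refine ⟨Real.exp (-(2 * μ * s₃)) / (2 * μ), by positivity, 1 / (2 * μ) - J s₃, s₃,
    fun s hs => ?_⟩
  have hd : ∀ x, HasDerivAt (fun x => J x - Real.exp (2 * μ * (x - s₃)) / (2 * μ))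
      (J' x - Real.exp (2 * μ * (x - s₃)) * (2 * μ * 1) / (2 * μ)) x := fun x =>
    (h1 x).sub ((hexp' x).div_const _)
  have := monotoneOn_Ici_of_hasDerivAt_nonneg (a := s₃) hd (fun x hx => by
      rw [mul_one, mul_div_cancel_right₀ _ (by positivity)]
      linarith [hJ'exp x hx]) (Set.mem_Ici.2 le_rfl) hs hs
  simp only [sub_self, mul_zero, Real.exp_zero] at this
  have e : Real.exp (2 * μ * (s - s₃)) / (2 * μ)
      = Real.exp (-(2 * μ * s₃)) / (2 * μ) * Real.exp (2 * μ * s) := by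
    rw [div_mul_eq_mul_div, ← Real.exp_add]
    ring_nf
  linarith

/-- The smooth subharmonic substitute `log (1 + |G|²)` for `2 log⁺ |G|`. -/
noncomputable def logPot (G : ℂ → ℂ) (ζ : ℂ) : ℝ := Real.log (1 + ‖G ζ‖ ^ 2)

/-- The derivative of `logPot G` in the direction `e`. -/
noncomputable def logPotD (G : ℂ → ℂ) (e ζ : ℂ) : ℝ :=
  2 * inner ℝ (G ζ) (e * deriv G ζ) / (1 + ‖G ζ‖ ^ 2)

/-- The second derivative of `logPot G` in the direction `e`. -/
noncomputable def logPotDD (G : ℂ → ℂ) (e ζ : ℂ) : ℝ :=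
  2 * (inner ℝ (G ζ) (e * (e * deriv (deriv G) ζ)) + inner ℝ (e * deriv G ζ) (e * deriv G ζ))
    / (1 + ‖G ζ‖ ^ 2) - logPotD G e ζ ^ 2

theorem logPot_nonneg (G : ℂ → ℂ) (ζ : ℂ) : 0 ≤ logPot G ζ :=
  Real.log_nonneg (by nlinarith [sq_nonneg ‖G ζ‖])

theorem logPot_hasDerivAt {G : ℂ → ℂ} (hG : Differentiable ℂ G) {γ : ℝ → ℂ} {e : ℂ} {t : ℝ}
    (hγ : HasDerivAt γ e t) : HasDerivAt (fun x => logPot G (γ x)) (logPotD G e (γ t)) t := by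
  have h1 : HasDerivAt (fun x => G (γ x)) (e * deriv G (γ t)) t :=
    (hG (γ t)).hasDerivAt.scomp t hγ
  exact (h1.norm_sq.const_add 1).log (by positivity)

theorem logPotD_hasDerivAt {G : ℂ → ℂ} (hG : Differentiable ℂ G) {γ : ℝ → ℂ} {e : ℂ} {t : ℝ}
    (hγ : HasDerivAt γ e t) :
    HasDerivAt (fun x => logPotD G e (γ x)) (logPotDD G e (γ t)) t := by
  have h1 : HasDerivAt (fun x => G (γ x)) (e * deriv G (γ t)) t :=
    (hG (γ t)).hasDerivAt.scomp t hγ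
  have h2 : HasDerivAt (fun x => deriv G (γ x)) (e * deriv (deriv G) (γ t)) t :=
    (hG.deriv (γ t)).hasDerivAt.scomp t hγ
  have h3 := ((h1.inner ℝ (h2.const_mul e)).const_mul 2).div (h1.norm_sq.const_add 1)
    (by positivity)
  refine h3.congr_deriv ?_
  have h4 : (1 + ‖G (γ t)‖ ^ 2) ≠ 0 := by positivity
  simp only [logPotDD, logPotD]
  field_simp

theorem continuous_logPot {G : ℂ → ℂ} (hG : Differentiable ℂ G) : Continuous (logPot G) := by
  have := hG.continuous
  exact Continuous.log (by fun_prop) fun ζ => by positivity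

theorem continuous_logPotD {G : ℂ → ℂ} (hG : Differentiable ℂ G) (e : ℂ) :
    Continuous (logPotD G e) := by
  have := hG.continuous
  have := hG.deriv.continuous
  exact Continuous.div (by fun_prop) (by fun_prop) fun ζ => by positivity

theorem continuous_logPotDD {G : ℂ → ℂ} (hG : Differentiable ℂ G) (e : ℂ) :
    Continuous (logPotDD G e) := by
  have := hG.continuous
  have := hG.deriv.continuous
  have := hG.deriv.deriv.continuous
  have := continuous_logPotD hG e
  exact (Continuous.div (by fun_prop) (by fun_prop) fun ζ => by positivity).sub (by fun_prop)

theorem logPotD_sq_add_sq (G : ℂ → ℂ) (ζ : ℂ) :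
    logPotD G 1 ζ ^ 2 + logPotD G Complex.I ζ ^ 2
      = 4 * ‖G ζ‖ ^ 2 * ‖deriv G ζ‖ ^ 2 / (1 + ‖G ζ‖ ^ 2) ^ 2 := by
  have h4 : (1 + ‖G ζ‖ ^ 2) ≠ 0 := by positivity
  simp only [logPotD, one_mul]
  field_simp
  simp only [Complex.sq_norm, Complex.normSq_apply, Complex.inner, Complex.mul_re, Complex.mul_im,
    Complex.conj_re, Complex.conj_im, Complex.I_re, Complex.I_im]
  ring

/-- `logPot G` is subharmonic. -/
theorem logPotDD_add_nonneg (G : ℂ → ℂ) (ζ : ℂ) :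
    0 ≤ logPotDD G 1 ζ + logPotDD G Complex.I ζ := by
  have h : logPotDD G 1 ζ + logPotDD G Complex.I ζ
      = 4 * ‖deriv G ζ‖ ^ 2 / (1 + ‖G ζ‖ ^ 2)
        - (logPotD G 1 ζ ^ 2 + logPotD G Complex.I ζ ^ 2) := by
    simp only [logPotDD]
    have h4 : (1 + ‖G ζ‖ ^ 2) ≠ 0 := by positivity
    field_simp
    simp only [Complex.sq_norm, Complex.normSq_apply, Complex.inner, Complex.mul_re,
      Complex.mul_im, Complex.conj_re, Complex.conj_im, Complex.I_re, Complex.I_im,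
      Complex.I_sq, Complex.neg_re, Complex.neg_im, Complex.one_re, Complex.one_im]
    ring
  have h4 : (1 + ‖G ζ‖ ^ 2) ≠ 0 := by positivity
  have h5 : logPotDD G 1 ζ + logPotDD G Complex.I ζ
      = 4 * ‖deriv G ζ‖ ^ 2 / (1 + ‖G ζ‖ ^ 2) ^ 2 := by
    rw [h, logPotD_sq_add_sq]
    field_simp
    ring
  rw [h5]
  positivity

theorem logPotD_add_period {G : ℂ → ℂ} {T : ℂ} (hT : ∀ ζ, G (ζ + T) = G ζ) (e ζ : ℂ) :
    logPotD G e (ζ + T) = logPotD G e ζ := by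
  have h : deriv G (ζ + T) = deriv G ζ := by
    rw [← deriv_comp_add_const]
    simp only [hT]
  simp only [logPotD, hT, h]

section CircleMean

variable {G : ℂ → ℂ}

/-- The derivative of the mean square of `logPot G` over a vertical segment of length `2π`. -/
theorem logPot_sq_integral_hasDerivAt (hG : Differentiable ℂ G) (s : ℝ) :
    HasDerivAt (fun x : ℝ => ∫ θ in (0 : ℝ)..2 * Real.pi, logPot G (x + θ * Complex.I) ^ 2)
      (∫ θ in (0 : ℝ)..2 * Real.pi,
        2 * logPot G (s + θ * Complex.I) * logPotD G 1 (s + θ * Complex.I)) s := by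
  have c0 := continuous_logPot hG
  have c1 := continuous_logPotD hG 1
  refine hasDerivAt_intervalIntegral_of_continuous
    (F := fun s θ => logPot G (s + θ * Complex.I) ^ 2)
    (F' := fun s θ => 2 * logPot G (s + θ * Complex.I) * logPotD G 1 (s + θ * Complex.I))
    0 (2 * Real.pi) (fun s => by fun_prop) (by fun_prop) (fun s θ => ?_) s
  have hγ : HasDerivAt (fun x : ℝ => (x : ℂ) + θ * Complex.I) 1 s :=
    (Complex.ofRealCLM.hasDerivAt (x := s)).add_const _
  exact ((logPot_hasDerivAt hG hγ).pow 2).congr_deriv (by simp)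

theorem logPot_mul_logPotD_integral_hasDerivAt (hG : Differentiable ℂ G) (s : ℝ) :
    HasDerivAt (fun x : ℝ => ∫ θ in (0 : ℝ)..2 * Real.pi,
        2 * logPot G (x + θ * Complex.I) * logPotD G 1 (x + θ * Complex.I))
      (∫ θ in (0 : ℝ)..2 * Real.pi, (2 * logPotD G 1 (s + θ * Complex.I) ^ 2
        + 2 * logPot G (s + θ * Complex.I) * logPotDD G 1 (s + θ * Complex.I))) s := by
  have c0 := continuous_logPot hG
  have c1 := continuous_logPotD hG 1
  have c2 := continuous_logPotDD hG 1
  refine hasDerivAt_intervalIntegral_of_continuous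
    (F := fun s θ => 2 * logPot G (s + θ * Complex.I) * logPotD G 1 (s + θ * Complex.I))
    (F' := fun s θ => 2 * logPotD G 1 (s + θ * Complex.I) ^ 2
        + 2 * logPot G (s + θ * Complex.I) * logPotDD G 1 (s + θ * Complex.I))
    0 (2 * Real.pi) (fun s => by fun_prop) (by fun_prop) (fun s θ => ?_) s
  have hγ : HasDerivAt (fun x : ℝ => (x : ℂ) + θ * Complex.I) 1 s :=
    (Complex.ofRealCLM.hasDerivAt (x := s)).add_const _
  exact (((logPot_hasDerivAt hG hγ).const_mul 2).mul (logPotD_hasDerivAt hG hγ)).congr_deriv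
    (by ring)

theorem hasDerivAt_vertical (s θ : ℝ) :
    HasDerivAt (fun x : ℝ => (s : ℂ) + x * Complex.I) Complex.I θ := by
  simpa using ((Complex.ofRealCLM.hasDerivAt (x := θ)).mul_const Complex.I).const_add (s : ℂ)

/-- The second derivative of the mean square of `logPot G` dominates twice the Dirichlet integral,
because `logPot G` is nonnegative, subharmonic and periodic. -/
theorem dirichlet_le_second_derivative (hG : Differentiable ℂ G)
    (hper : ∀ ζ, G (ζ + 2 * Real.pi * Complex.I) = G ζ) (s : ℝ) :
    2 * (∫ θ in (0 : ℝ)..2 * Real.pi, logPotD G 1 (s + θ * Complex.I) ^ 2)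
        + 2 * (∫ θ in (0 : ℝ)..2 * Real.pi, logPotD G Complex.I (s + θ * Complex.I) ^ 2)
      ≤ ∫ θ in (0 : ℝ)..2 * Real.pi, (2 * logPotD G 1 (s + θ * Complex.I) ^ 2
        + 2 * logPot G (s + θ * Complex.I) * logPotDD G 1 (s + θ * Complex.I)) := by
  have c0 := continuous_logPot hG
  have c1 := fun e => continuous_logPotD hG e
  have c2 := fun e => continuous_logPotDD hG e
  have hz : ∫ θ in (0 : ℝ)..2 * Real.pi, (2 * logPotD G Complex.I (s + θ * Complex.I) ^ 2
      + 2 * logPot G (s + θ * Complex.I) * logPotDD G Complex.I (s + θ * Complex.I)) = 0 := by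
    rw [intervalIntegral.integral_eq_sub_of_hasDerivAt
      (f := fun θ : ℝ => 2 * logPot G (s + θ * Complex.I) * logPotD G Complex.I (s + θ * Complex.I))
      (fun θ _ => (((logPot_hasDerivAt hG (hasDerivAt_vertical s θ)).const_mul 2).mul
        (logPotD_hasDerivAt hG (hasDerivAt_vertical s θ))).congr_deriv (by ring))
      (Continuous.intervalIntegrable (by fun_prop) _ _)]
    have e : (s : ℂ) + ((2 * Real.pi : ℝ) : ℂ) * Complex.I
        = (s + (0 : ℝ) * Complex.I) + 2 * Real.pi * Complex.I := by push_cast; ring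
    rw [e, logPotD_add_period hper, sub_eq_zero]
    simp only [logPot, hper]
  refine le_of_le_of_eq ?_ ((congrArg (fun x => (∫ θ in (0 : ℝ)..2 * Real.pi,
    (2 * logPotD G 1 (s + θ * Complex.I) ^ 2
      + 2 * logPot G (s + θ * Complex.I) * logPotDD G 1 (s + θ * Complex.I))) + x) hz).trans
    (add_zero _))
  rw [← intervalIntegral.integral_const_mul, ← intervalIntegral.integral_const_mul,
    ← intervalIntegral.integral_add (Continuous.intervalIntegrable (by fun_prop) _ _)
      (Continuous.intervalIntegrable (by fun_prop) _ _),
    ← intervalIntegral.integral_add (Continuous.intervalIntegrable (by fun_prop) _ _)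
      (Continuous.intervalIntegrable (by fun_prop) _ _)]
  refine intervalIntegral.integral_mono_on (by positivity)
    (Continuous.intervalIntegrable (by fun_prop) _ _)
    (Continuous.intervalIntegrable (by fun_prop) _ _) fun θ _ => ?_
  nlinarith [mul_nonneg (logPot_nonneg G (s + θ * Complex.I))
    (logPotDD_add_nonneg G (s + θ * Complex.I))]

/-- Carleman's estimate on a segment where `G` takes a value of modulus at most `c`. -/
theorem carleman_segment (hG : Differentiable ℂ G)
    (hper : ∀ ζ, G (ζ + 2 * Real.pi * Complex.I) = G ζ) {μ c : ℝ} (hμ0 : 0 < μ)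
    (hμ : μ < 1 / 2) {s θ₀ : ℝ} (hθ₀ : ‖G (s + θ₀ * Complex.I)‖ ≤ c) :
    μ ^ 2 * (∫ θ in (0 : ℝ)..2 * Real.pi, logPot G (s + θ * Complex.I) ^ 2)
        - 2 * μ * Real.tan (μ * Real.pi) * Real.log (1 + c ^ 2) ^ 2
      ≤ ∫ θ in (0 : ℝ)..2 * Real.pi, logPotD G Complex.I (s + θ * Complex.I) ^ 2 := by
  have c1 := continuous_logPotD hG Complex.I
  have hshift : ∀ θ : ℝ, (s : ℂ) + ((θ + 2 * Real.pi : ℝ) : ℂ) * Complex.I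
      = (s + θ * Complex.I) + 2 * Real.pi * Complex.I := fun θ => by push_cast; ring
  have hu : Function.Periodic (fun θ : ℝ => logPot G (s + θ * Complex.I)) (2 * Real.pi) := by
    intro θ
    simp only [hshift, logPot, hper]
  have hv : Function.Periodic (fun θ : ℝ => logPotD G Complex.I (s + θ * Complex.I) ^ 2)
      (2 * Real.pi) := by
    intro θ
    simp only [hshift, logPotD_add_period hper]
  have hu2 : Function.Periodic (fun θ : ℝ => logPot G (s + θ * Complex.I) ^ 2)
      (2 * Real.pi) := fun θ => by simp only [hu θ]
  have h1 := wirtinger_two_pi (f := fun θ : ℝ => logPot G (s + θ * Complex.I))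
    (fun θ => logPot_hasDerivAt hG (hasDerivAt_vertical s θ)) (by fun_prop) hμ0 hμ θ₀ (hu θ₀)
  have h2 := hu2.intervalIntegral_add_eq θ₀ 0
  have h3 := hv.intervalIntegral_add_eq θ₀ 0
  rw [zero_add] at h2 h3
  simp only [h2, h3] at h1
  have h4 : logPot G (s + θ₀ * Complex.I) ^ 2 ≤ Real.log (1 + c ^ 2) ^ 2 := by
    refine pow_le_pow_left₀ (logPot_nonneg _ _) (Real.log_le_log (by positivity) ?_) 2
    gcongr
  have h5 : 0 ≤ Real.tan (μ * Real.pi) :=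
    Real.tan_nonneg_of_nonneg_of_le_pi_div_two (by positivity) (by nlinarith [Real.pi_pos])
  have h6 := mul_le_mul_of_nonneg_left h4 (show 0 ≤ 2 * μ * Real.tan (μ * Real.pi) by positivity)
  linarith

end CircleMean

theorem logPot_sq_integral_le {G : ℂ → ℂ} (hG : Differentiable ℂ G) {s N : ℝ}
    (hN : ∀ θ : ℝ, ‖G (s + θ * Complex.I)‖ ≤ N) :
    ∫ θ in (0 : ℝ)..2 * Real.pi, logPot G (s + θ * Complex.I) ^ 2
      ≤ 2 * Real.pi * Real.log (1 + N ^ 2) ^ 2 := by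
  have c0 := continuous_logPot hG
  have h : ∫ θ in (0 : ℝ)..2 * Real.pi, logPot G (s + θ * Complex.I) ^ 2
      ≤ ∫ _θ in (0 : ℝ)..2 * Real.pi, Real.log (1 + N ^ 2) ^ 2 := by
    refine intervalIntegral.integral_mono_on (by positivity)
      (Continuous.intervalIntegrable (by fun_prop) _ _) (by simp) fun θ _ => ?_
    refine pow_le_pow_left₀ (logPot_nonneg _ _) (Real.log_le_log (by positivity) ?_) 2
    have := hN θ
    gcongr
  simpa using h

theorem exists_ne_zero_mul_deriv_ne_zero {g : ℂ → ℂ} (hg : Differentiable ℂ g) {z : ℂ}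
    (hz : deriv g z ≠ 0) : ∃ w, w ≠ 0 ∧ g w * deriv g w ≠ 0 := by
  by_contra! h
  have hgc := hg.continuous
  have hdc := hg.deriv.continuous
  have h0 : (fun w => g w * deriv g w) = fun _ => 0 :=
    Continuous.ext_on (dense_compl_singleton (0 : ℂ)) (by fun_prop) continuous_const
      fun w hw => h w hw
  have h1 : g =ᶠ[nhds z] fun _ => 0 := by
    filter_upwards [hdc.continuousAt.eventually_ne hz] with w hw
    exact (mul_eq_zero.1 (congrFun h0 w)).resolve_right hw
  exact hz (by rw [h1.deriv_eq]; simp)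

/-- A weak form of the `cos πρ` theorem: the minimum modulus of a nonconstant entire function of
order less than `1/2` is not bounded on all large circles. -/
theorem not_eventually_min_modulus_le {g : ℂ → ℂ} (hg : Differentiable ℂ g)
    (hne : ∃ z, deriv g z ≠ 0) {ρ : ℝ} (hρ0 : 0 < ρ) (hρ : ρ < 1 / 2)
    (horder : ∀ᶠ r : ℝ in Filter.atTop, ∀ w : ℂ, ‖w‖ ≤ r → ‖g w‖ ≤ Real.exp (r ^ ρ)) (c : ℝ) :
    ¬ ∀ᶠ r : ℝ in Filter.atTop, ∃ w : ℂ, ‖w‖ = r ∧ ‖g w‖ ≤ c := by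
  intro hmin
  have hpi := Real.pi_pos
  set G : ℂ → ℂ := fun ζ => g (Complex.exp ζ) with hGdef
  have hG : Differentiable ℂ G := hg.comp Complex.differentiable_exp
  have hper : ∀ ζ, G (ζ + 2 * Real.pi * Complex.I) = G ζ := fun ζ => by
    simp only [hGdef, Complex.exp_add, Complex.exp_two_pi_mul_I, mul_one]
  have hnorm : ∀ s θ : ℝ, ‖Complex.exp (s + θ * Complex.I)‖ = Real.exp s := fun s θ => by
    simp [Complex.norm_exp]
  have c0 := continuous_logPot hG
  have c1 := fun e => continuous_logPotD hG e
  set J : ℝ → ℝ := fun s => ∫ θ in (0 : ℝ)..2 * Real.pi, logPot G (s + θ * Complex.I) ^ 2 with hJ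
  set J' : ℝ → ℝ := fun s => ∫ θ in (0 : ℝ)..2 * Real.pi,
    2 * logPot G (s + θ * Complex.I) * logPotD G 1 (s + θ * Complex.I) with hJ'
  set J'' : ℝ → ℝ := fun s => ∫ θ in (0 : ℝ)..2 * Real.pi, (2 * logPotD G 1 (s + θ * Complex.I) ^ 2
    + 2 * logPot G (s + θ * Complex.I) * logPotDD G 1 (s + θ * Complex.I)) with hJ''
  set A : ℝ → ℝ := fun s => ∫ θ in (0 : ℝ)..2 * Real.pi, logPotD G 1 (s + θ * Complex.I) ^ 2
    with hA
  set A' : ℝ → ℝ := fun s => ∫ θ in (0 : ℝ)..2 * Real.pi,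
    logPotD G Complex.I (s + θ * Complex.I) ^ 2 with hA'
  have hJd : ∀ s, HasDerivAt J (J' s) s := logPot_sq_integral_hasDerivAt hG
  have hJ'd : ∀ s, HasDerivAt J' (J'' s) s := logPot_mul_logPotD_integral_hasDerivAt hG
  have hdir : ∀ s, 2 * A s + 2 * A' s ≤ J'' s := dirichlet_le_second_derivative hG hper
  have hA0 : ∀ s, 0 ≤ A s := fun s =>
    intervalIntegral.integral_nonneg (by positivity) fun _ _ => sq_nonneg _
  have hA'0 : ∀ s, 0 ≤ A' s := fun s =>
    intervalIntegral.integral_nonneg (by positivity) fun _ _ => sq_nonneg _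
  have hJ'ne : ∃ s, J' s ≠ 0 := by
    by_contra! h
    have h'' : ∀ s, J'' s = 0 := fun s => by
      refine (hJ'd s).unique ?_
      rw [show J' = fun _ => 0 from funext h]
      exact hasDerivAt_const s 0
    obtain ⟨z, hz⟩ := hne
    obtain ⟨w, hw0, hw⟩ := exists_ne_zero_mul_deriv_ne_zero hg hz
    set s := Real.log ‖w‖
    set θ := (-w).arg + Real.pi
    have hζ : Complex.exp (s + θ * Complex.I) = w := by
      have e : (s : ℂ) + θ * Complex.I = Complex.log (-w) + Real.pi * Complex.I := by
        simp only [Complex.log, norm_neg, s, θ]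
        push_cast
        ring
      rw [e, Complex.exp_add, Complex.exp_log (neg_ne_zero.2 hw0), Complex.exp_pi_mul_I]
      ring
    have hpos : 0 < ∫ θ in (0 : ℝ)..2 * Real.pi, (logPotD G 1 (s + θ * Complex.I) ^ 2
        + logPotD G Complex.I (s + θ * Complex.I) ^ 2) := by
      refine intervalIntegral.integral_pos (by positivity) (by fun_prop)
        (fun _ _ => by positivity) ⟨θ, ⟨?_, ?_⟩, ?_⟩
      · linarith [Complex.neg_pi_lt_arg (-w)]
      · linarith [Complex.arg_le_pi (-w)]
      · have hd : deriv G (s + θ * Complex.I) = deriv g w * w := by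
          have := (hg (Complex.exp (s + θ * Complex.I))).hasDerivAt.comp _
            (Complex.hasDerivAt_exp (s + θ * Complex.I))
          rw [hζ] at this
          exact this.deriv
        rw [logPotD_sq_add_sq, hd, show G (s + θ * Complex.I) = g w by simp only [hGdef, hζ]]
        have hg0 := norm_pos_iff.2 (left_ne_zero_of_mul hw)
        have hg1 := norm_pos_iff.2 (mul_ne_zero (right_ne_zero_of_mul hw) hw0)
        positivity
    rw [intervalIntegral.integral_add (Continuous.intervalIntegrable (by fun_prop) _ _)
      (Continuous.intervalIntegrable (by fun_prop) _ _)] at hpos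
    have := hdir s
    rw [h''] at this
    simp only [hA, hA'] at this
    linarith
  obtain ⟨μ, hρμ, hμ⟩ := exists_between hρ
  have hμ0 : 0 < μ := hρ0.trans hρμ
  obtain ⟨N, hN⟩ := (isCompact_closedBall (0 : ℂ) 1).exists_bound_of_continuousOn
    hg.continuous.continuousOn
  obtain ⟨s₀, hs₀⟩ := Filter.eventually_atTop.1
    (Real.tendsto_exp_atTop.eventually (horder.and hmin))
  set C := 2 * μ * Real.tan (μ * Real.pi) * Real.log (1 + c ^ 2) ^ 2 with hC
  have hC0 : 0 ≤ C := by
    have : 0 ≤ Real.tan (μ * Real.pi) :=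
      Real.tan_nonneg_of_nonneg_of_le_pi_div_two (by positivity) (by nlinarith)
    positivity
  have hcarl : ∀ s, s₀ ≤ s → μ ^ 2 * J s - C ≤ A' s := by
    intro s hs
    obtain ⟨w, hw, hwc⟩ := (hs₀ s hs).2
    refine carleman_segment (θ₀ := w.arg) hG hper hμ0 hμ ?_
    have : Complex.exp (s + w.arg * Complex.I) = w := by
      rw [Complex.exp_add, ← Complex.ofReal_exp, ← hw, Complex.norm_mul_exp_arg_mul_I]
    simpa only [hGdef, this] using hwc
  have hcs : ∀ s, μ * J' s - μ ^ 2 * J s ≤ A s := by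
    intro s
    simp only [hA, hJ, hJ']
    rw [← intervalIntegral.integral_const_mul, ← intervalIntegral.integral_const_mul,
      ← intervalIntegral.integral_sub (Continuous.intervalIntegrable (by fun_prop) _ _)
        (Continuous.intervalIntegrable (by fun_prop) _ _)]
    refine intervalIntegral.integral_mono_on (by positivity)
      (Continuous.intervalIntegrable (by fun_prop) _ _)
      (Continuous.intervalIntegrable (by fun_prop) _ _) fun θ _ => ?_
    nlinarith [sq_nonneg (logPotD G 1 (s + θ * Complex.I) - μ * logPot G (s + θ * Complex.I))]
  obtain ⟨a, ha, D, s₁, hgrow⟩ := exp_growth_of_convex hJd hJ'd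
    (fun s => by linarith [hdir s, hA0 s, hA'0 s])
    (B := 2 * Real.pi * Real.log (1 + N ^ 2) ^ 2)
    (fun s hs => logPot_sq_integral_le hG fun θ => hN _ (by
      rw [mem_closedBall_zero_iff, hnorm]
      exact Real.exp_le_one_iff.2 hs))
    hJ'ne hμ0 hC0 (s₀ := s₀)
    (fun s hs => by linarith [hdir s, hA0 s, hcarl s hs])
    (fun s hs => by linarith [hdir s, hcs s, hcarl s hs])
  have hupper : ∀ s, s₀ ≤ s → 0 ≤ s → J s ≤ 18 * Real.pi * Real.exp (2 * ρ * s) := by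
    intro s hs hs0
    have h1 := logPot_sq_integral_le hG (s := s) (N := Real.exp (Real.exp (s * ρ))) fun θ => by
      rw [Real.exp_mul]
      exact (hs₀ s hs).1 _ (hnorm s θ).le
    set E := Real.exp (s * ρ) with hE
    have hE1 : 1 ≤ E := Real.one_le_exp (by positivity)
    have h2 : Real.log (1 + Real.exp E ^ 2) ≤ 3 * E := by
      rw [Real.log_le_iff_le_exp (by positivity)]
      have e : Real.exp (3 * E) = Real.exp E ^ 3 := by rw [← Real.exp_nat_mul]; norm_num
      have h3 := Real.add_one_le_exp E
      rw [e]
      nlinarith [sq_nonneg (Real.exp E)]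
    have h4 : Real.log (1 + Real.exp E ^ 2) ^ 2 ≤ (3 * E) ^ 2 :=
      pow_le_pow_left₀ (Real.log_nonneg (by nlinarith [sq_nonneg (Real.exp E)])) h2 2
    have h5 : Real.exp (2 * ρ * s) = E ^ 2 := by
      rw [hE, ← Real.exp_nat_mul]
      push_cast
      ring_nf
    rw [h5]
    nlinarith [mul_le_mul_of_nonneg_left h4 (show 0 ≤ 2 * Real.pi by positivity)]
  set δ := 2 * (μ - ρ)
  have hδ : 0 < δ := by simp only [δ]; linarith
  set s := max (max s₀ s₁) (max 0 ((18 * Real.pi + |D|) / (a * δ)))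
  have e1 : s₀ ≤ s := (le_max_left _ _).trans (le_max_left _ _)
  have e2 : s₁ ≤ s := (le_max_right _ _).trans (le_max_left _ _)
  have e3 : 0 ≤ s := (le_max_left _ _).trans (le_max_right _ _)
  have e4 : (18 * Real.pi + |D|) / (a * δ) ≤ s := (le_max_right _ _).trans (le_max_right _ _)
  have h1 := (hgrow s e2).trans (hupper s e1 e3)
  rw [div_le_iff₀ (by positivity)] at e4
  have h2 : Real.exp (2 * μ * s) = Real.exp (δ * s) * Real.exp (2 * ρ * s) := by
    rw [← Real.exp_add]
    simp only [δ]
    ring_nf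
  have h3 : 1 ≤ Real.exp (2 * ρ * s) := Real.one_le_exp (by positivity)
  have h4 := Real.add_one_le_exp (δ * s)
  have h5 : |D| ≤ |D| * Real.exp (2 * ρ * s) := le_mul_of_one_le_right (abs_nonneg _) h3
  have h6 : a * Real.exp (δ * s) ≤ 18 * Real.pi + |D| := by
    refine le_of_mul_le_mul_right ?_ (Real.exp_pos (2 * ρ * s))
    rw [h2] at h1
    linarith [le_abs_self D]
  linarith [mul_le_mul_of_nonneg_left h4 ha.le]

/-- Let `g` be transcendental entire of order `ρ(g) < 1/2` and `f = -i g / g'`. Then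
along every trajectory of `ż = f(z)` the modulus `|g(z(t))|` is constant, and every
trajectory of `ż = f(z)` is bounded. -/
theorem stmt7 (g : ℂ → ℂ) (hg : Differentiable ℂ g)
    (htrans : ¬ ∃ p : Polynomial ℂ, g = fun w => p.eval w)
    (ρ : ℝ) (hρ0 : 0 < ρ) (hρ : ρ < 1 / 2)
    (horder : ∀ᶠ r : ℝ in Filter.atTop, ∀ w : ℂ, ‖w‖ ≤ r → ‖g w‖ ≤ Real.exp (r ^ ρ))
    (z : ℝ → ℂ) (α β : EReal)
    (hz : ∀ t : ℝ, α < (t : EReal) → (t : EReal) < β →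
      deriv g (z t) ≠ 0 ∧ HasDerivAt z (-Complex.I * g (z t) / deriv g (z t)) t) :
    (∀ s t : ℝ, α < (s : EReal) → (s : EReal) < β → α < (t : EReal) → (t : EReal) < β →
      ‖g (z s)‖ = ‖g (z t)‖) ∧
    ∃ M : ℝ, ∀ t : ℝ, α < (t : EReal) → (t : EReal) < β → ‖z t‖ ≤ M := by
  have hderiv : ∀ t : ℝ, α < (t : EReal) → (t : EReal) < β →
      HasDerivAt (fun x => ‖g (z x)‖ ^ 2) 0 t := by
    intro t h1 h2
    obtain ⟨h3, h4⟩ := hz t h1 h2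
    refine (((hg (z t)).hasDerivAt.scomp t h4).norm_sq).congr_deriv ?_
    rw [smul_eq_mul, div_mul_cancel₀ _ h3]
    simp only [Function.comp, Complex.inner, Complex.mul_re, Complex.mul_im, Complex.conj_re,
      Complex.conj_im, Complex.neg_re, Complex.neg_im, Complex.I_re, Complex.I_im]
    ring
  have hle : ∀ s t : ℝ, s ≤ t → α < (s : EReal) → (t : EReal) < β → ‖g (z s)‖ = ‖g (z t)‖ := by
    intro s t hst hs ht
    have hd : ∀ x ∈ Set.Icc s t, HasDerivAt (fun x => ‖g (z x)‖ ^ 2) 0 x := fun x hx =>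
      hderiv x (hs.trans_le (EReal.coe_le_coe_iff.2 hx.1))
        ((EReal.coe_le_coe_iff.2 hx.2).trans_lt ht)
    have := constant_of_has_deriv_right_zero
      (fun x hx => (hd x hx).continuousAt.continuousWithinAt)
      (fun x hx => (hd x (Set.Ico_subset_Icc_self hx)).hasDerivWithinAt) t ⟨hst, le_rfl⟩
    exact ((pow_left_inj₀ (norm_nonneg _) (norm_nonneg _) two_ne_zero).1 this).symm
  have hconst : ∀ s t : ℝ, α < (s : EReal) → (s : EReal) < β → α < (t : EReal) →
      (t : EReal) < β → ‖g (z s)‖ = ‖g (z t)‖ := by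
    intro s t hs hs' ht ht'
    rcases le_total s t with h | h
    · exact hle s t h hs ht'
    · exact (hle t s h ht hs').symm
  refine ⟨hconst, ?_⟩
  by_contra! hunb
  obtain ⟨t₀, ht₀, ht₀', -⟩ := hunb 0
  refine not_eventually_min_modulus_le hg ⟨z t₀, (hz t₀ ht₀ ht₀').1⟩ hρ0 hρ horder ‖g (z t₀)‖ ?_
  filter_upwards [Filter.eventually_ge_atTop ‖z t₀‖] with r hr
  obtain ⟨t₁, ht₁, ht₁', hr₁⟩ := hunb r
  have hS : Set.OrdConnected {t : ℝ | α < (t : EReal) ∧ (t : EReal) < β} :=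
    ⟨fun x hx y hy w hw => ⟨hx.1.trans_le (EReal.coe_le_coe_iff.2 hw.1),
      (EReal.coe_le_coe_iff.2 hw.2).trans_lt hy.2⟩⟩
  obtain ⟨t, ht, htr⟩ := hS.isPreconnected.intermediate_value (f := fun t => ‖z t‖)
    (show t₀ ∈ _ from ⟨ht₀, ht₀'⟩) (show t₁ ∈ _ from ⟨ht₁, ht₁'⟩)
    (fun t ht => (hz t ht.1 ht.2).2.continuousAt.norm.continuousWithinAt) ⟨hr, hr₁.le⟩
  exact ⟨z t, htr, (hconst t t₀ ht.1 ht.2 ht₀ ht₀').le⟩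
end

section
/- Let φ be holomorphic and univalent on H = {Re v > 0} and define ψ(w) = ∫_w^{+∞} e^{−t} φ′(t) dt (the contour eventually along a real interval). Then ψ is holomorphic on H, and along the region H₁ = {x + iy : x > N₁, −√x < y < √x} one has ψ(w) ~ e^{−w} φ′(Re w) as w → ∞ in H₁; in particular λ(w) = −log ψ(w) = w + O(log|w|) as w → ∞ in H₁. -/
open Filter Topology Set MeasureTheory

theorem deriv_ne_zero_of_injOn {f : ℂ → ℂ} {U : Set ℂ} {p : ℂ} (hU : IsOpen U)
    (hf : DifferentiableOn ℂ f U) (hi : InjOn f U) (hp : p ∈ U) : deriv f p ≠ 0 := by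
  have han : ∀ q ∈ U, AnalyticAt ℂ f q := fun q hq => hf.analyticAt (hU.mem_nhds hq)
  have hloc : ∀ q ∈ U, 𝓝 (f q) ≤ map f (𝓝 q) := by
    intro q hq
    refine (han q hq).eventually_constant_or_nhds_le_map_nhds.resolve_left fun hc => ?_
    obtain ⟨z, ⟨hz, hzU⟩, hzq⟩ :=
      ((hc.and (hU.mem_nhds hq)).filter_mono nhdsWithin_le_nhds |>.and
        (self_mem_nhdsWithin : {q}ᶜ ∈ 𝓝[≠] q)).exists
    exact hzq (hi hzU hq hz)
  set g := Function.invFunOn f U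
  have hgf : ∀ q ∈ U, g (f q) = q := fun q hq => hi.leftInvOn_invFunOn hq
  have hgc : ∀ q ∈ U, ContinuousAt g (f q) := by
    intro q hq
    rw [ContinuousAt, hgf q hq]
    refine Tendsto.mono_left ?_ (hloc q hq)
    rw [tendsto_map'_iff]
    refine tendsto_id.congr' ?_
    filter_upwards [hU.mem_nhds hq] with z hz
    exact (hgf z hz).symm
  have himg : ∀ q ∈ U, ∀ V ∈ 𝓝 q, f '' V ∈ 𝓝 (f q) := fun q hq V hV =>
    hloc q hq (image_mem_map hV)
  have hd : ∀ᶠ q in 𝓝[≠] p, deriv f q ≠ 0 := by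
    refine (han p hp).deriv.eventually_eq_zero_or_eventually_ne_zero.resolve_left fun hc => ?_
    obtain ⟨ε, hε, hball⟩ := Metric.eventually_nhds_iff_ball.1 (hc.and (hU.mem_nhds hp))
    have hconst : ∀ z ∈ Metric.ball p ε, f z = f p := by
      intro z hz
      refine (convex_ball p ε).is_const_of_fderivWithin_eq_zero (𝕜 := ℂ)
        (hf.mono fun x hx => (hball x hx).2) (fun x hx => ?_) hz (Metric.mem_ball_self hε)
      rw [fderivWithin_of_isOpen Metric.isOpen_ball hx]
      ext
      simpa using (hball x hx).1
    have hmem : ∀ᶠ z in 𝓝 p, z ∈ Metric.ball p ε := Metric.ball_mem_nhds p hε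
    obtain ⟨z, hz, hzq⟩ := (hmem.filter_mono nhdsWithin_le_nhds |>.and
      (self_mem_nhdsWithin : {p}ᶜ ∈ 𝓝[≠] p)).exists
    exact hzq (hi (hball z hz).2 hp (hconst z hz))
  have hga : AnalyticAt ℂ g (f p) := by
    refine Complex.analyticAt_of_differentiable_on_punctured_nhds_of_continuousAt ?_ (hgc p hp)
    rw [eventually_nhdsWithin_iff] at hd ⊢
    filter_upwards [himg p hp _ (inter_mem hd (hU.mem_nhds hp))]
    rintro _ ⟨q, ⟨hq, hqU⟩, rfl⟩ hne
    have hqp : q ≠ p := fun h => hne (by rw [h]; rfl)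
    refine (HasDerivAt.of_local_left_inverse (f := f) (hgc q hqU) (f' := deriv f q) ?_ (hq hqp)
      ?_).differentiableAt
    · rw [hgf q hqU]
      exact (han q hqU).differentiableAt.hasDerivAt
    · filter_upwards [himg q hqU U (hU.mem_nhds hqU)]
      rintro _ ⟨x, hx, rfl⟩
      rw [hgf x hx]
  intro h0
  have h1 := hga.differentiableAt.hasDerivAt.comp p (han p hp).differentiableAt.hasDerivAt
  have h2 : HasDerivAt (g ∘ f) 1 p := by
    refine (hasDerivAt_id p).congr_of_eventuallyEq ?_
    filter_upwards [hU.mem_nhds hp] with z hz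
    exact hgf z hz
  have h3 := h1.unique h2
  rw [h0, mul_zero] at h3
  exact zero_ne_one h3

theorem exists_mem_sphere_norm_le_one {f : ℂ → ℂ} (hf : DifferentiableOn ℂ f (Metric.ball 0 1))
    (hi : InjOn f (Metric.ball 0 1)) (h0 : f 0 = 0) (h1 : deriv f 0 = 1) {r : ℝ} (hr : 0 < r)
    (hr1 : r < 1) : ∃ z ∈ Metric.sphere (0 : ℂ) r, ‖f z‖ ≤ 1 := by
  by_contra! hcon
  have hsub : Metric.closedBall (0 : ℂ) r ⊆ Metric.ball 0 1 := Metric.closedBall_subset_ball hr1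
  have hval : ∀ z : ℂ, z ≠ 0 → dslope f 0 z = f z / z := by
    intro z hz
    rw [dslope_of_ne _ hz, slope_def_field, h0, sub_zero, sub_zero]
  have hne : ∀ z ∈ Metric.ball (0 : ℂ) 1, dslope f 0 z ≠ 0 := by
    intro z hz
    by_cases hz0 : z = 0
    · rw [hz0, dslope_same, h1]
      exact one_ne_zero
    · rw [hval z hz0]
      refine div_ne_zero (fun h => hz0 (hi hz (Metric.mem_ball_self one_pos) (h.trans h0.symm))) hz0
  have hd : DifferentiableOn ℂ (dslope f 0) (Metric.ball 0 1) :=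
    (Complex.differentiableOn_dslope (Metric.ball_mem_nhds _ one_pos)).2 hf
  have hd' : DiffContOnCl ℂ (fun z => (dslope f 0 z)⁻¹) (Metric.ball 0 r) := by
    refine DifferentiableOn.diffContOnCl ?_
    rw [closure_ball _ hr.ne']
    exact (hd.mono hsub).inv fun z hz => hne z (hsub hz)
  have hle := Complex.norm_le_of_forall_mem_frontier_norm_le Metric.isBounded_ball hd' (C := r)
    (fun z hz => by
      rw [frontier_ball _ hr.ne'] at hz
      have hz' : ‖z‖ = r := by simpa using hz
      have hz0 : z ≠ 0 := by
        rintro rfl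
        simp at hz'
        exact hr.ne hz'
      have := hcon z hz
      rw [hval z hz0, inv_div, norm_div, hz']
      exact div_le_self hr.le this.le) (subset_closure (Metric.mem_ball_self hr))
  rw [dslope_same, h1] at hle
  simp at hle
  linarith

theorem le_integral_normSq_deriv_of_norm_le_one_of_two_le {F F' : ℝ → ℂ} {a b α β : ℝ}
    (hF : ∀ t, HasDerivAt F (F' t) t) (hF' : Continuous F') (hab : a < b) (hα : α ∈ Icc a b)
    (hβ : β ∈ Icc a b) (h1 : ‖F α‖ ≤ 1) (h2 : 2 ≤ ‖F β‖) :
    1 / (16 * (b - a)) ≤ ∫ t in a..b, ‖F' t‖ ^ 2 / (1 + ‖F t‖ ^ 2) ^ 2 := by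
  have hFc : Continuous F := continuous_iff_continuousAt.2 fun t => (hF t).continuousAt
  have hpos : ∀ t, 0 < 1 + ‖F t‖ ^ 2 := fun t => by positivity
  set u : ℝ → ℝ := fun t => -(1 + ‖F t‖ ^ 2)⁻¹ with hu
  set u' : ℝ → ℝ := fun t => 2 * inner ℝ (F t) (F' t) / (1 + ‖F t‖ ^ 2) ^ 2 with hu'
  have hud : ∀ t, HasDerivAt u (u' t) t := by
    intro t
    have := (((hF t).norm_sq.const_add 1).inv (hpos t).ne').neg
    refine this.congr_deriv ?_
    simp only [hu']
    ring
  have hu'c : Continuous u' := by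
    simp only [hu']
    exact (continuous_const.mul (hFc.inner hF')).div (by fun_prop) fun t => by
      have := hpos t
      positivity
  have hdc : Continuous fun t => ‖F' t‖ ^ 2 / (1 + ‖F t‖ ^ 2) ^ 2 :=
    Continuous.div (by fun_prop) (by fun_prop) fun t => by
      have := hpos t
      positivity
  have hdc' : ∀ k : ℝ, Continuous fun t => k * (‖F' t‖ ^ 2 / (1 + ‖F t‖ ^ 2) ^ 2) := fun k =>
    continuous_const.mul hdc
  set l := b - a with hl
  have hl0 : 0 < l := sub_pos.2 hab
  have hbd : ∀ t, |u' t| ≤ 1 / (8 * l) + 2 * l * (‖F' t‖ ^ 2 / (1 + ‖F t‖ ^ 2) ^ 2) := by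
    intro t
    have hin : |inner ℝ (F t) (F' t)| ≤ ‖F t‖ * ‖F' t‖ := abs_real_inner_le_norm _ _
    have e1 : |u' t| ≤ ‖F' t‖ / (1 + ‖F t‖ ^ 2) := by
      simp only [hu']
      rw [abs_div, abs_mul, abs_of_pos (pow_pos (hpos t) 2), abs_two, div_le_div_iff₀
        (pow_pos (hpos t) 2) (hpos t)]
      have : 2 * |inner ℝ (F t) (F' t)| ≤ ‖F' t‖ * (1 + ‖F t‖ ^ 2) := by
        nlinarith [mul_nonneg (norm_nonneg (F' t)) (sq_nonneg (‖F t‖ - 1))]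
      nlinarith [mul_le_mul_of_nonneg_right this (hpos t).le]
    refine e1.trans ?_
    rw [← div_pow]
    set y := ‖F' t‖ / (1 + ‖F t‖ ^ 2)
    have : 1 / (8 * l) + 2 * l * y ^ 2 - y = 2 * l * (y - 1 / (4 * l)) ^ 2 := by
      field_simp
      ring
    have h3 : 0 ≤ 2 * l * (y - 1 / (4 * l)) ^ 2 := by positivity
    linarith
  have hint : IntervalIntegrable u' volume α β := hu'c.intervalIntegrable α β
  have hftc := intervalIntegral.integral_eq_sub_of_hasDerivAt (fun t _ => hud t) hint
  have hgap : 1 / 4 ≤ u β - u α := by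
    simp only [hu]
    have ha : (1 / 2 : ℝ) ≤ (1 + ‖F α‖ ^ 2)⁻¹ := by
      rw [one_div]
      exact inv_anti₀ (hpos α) (by nlinarith [norm_nonneg (F α)])
    have hb : (1 + ‖F β‖ ^ 2)⁻¹ ≤ (1 / 5 : ℝ) := by
      rw [one_div]
      exact inv_anti₀ (by norm_num) (by nlinarith)
    linarith
  have habs : u β - u α ≤ ∫ t in a..b, |u' t| := by
    rw [← hftc]
    refine (le_abs_self _).trans ?_
    refine (intervalIntegral.norm_integral_le_integral_norm_uIoc (f := u')).trans ?_
    rw [intervalIntegral.integral_of_le hab.le]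
    refine setIntegral_mono_set ?_ (ae_of_all _ fun t => abs_nonneg _) ?_
    · exact (hu'c.abs.integrableOn_Icc).mono_set Ioc_subset_Icc_self
    · exact LE.le.eventuallyLE (Ioc_subset_Ioc (le_min hα.1 hβ.1) (max_le hα.2 hβ.2))
  have hmono : ∫ t in a..b, |u' t| ≤
      ∫ t in a..b, (1 / (8 * l) + 2 * l * (‖F' t‖ ^ 2 / (1 + ‖F t‖ ^ 2) ^ 2)) :=
    intervalIntegral.integral_mono_on hab.le (hu'c.abs.intervalIntegrable _ _)
      ((continuous_const.add (hdc' _)).intervalIntegrable _ _) fun t _ => hbd t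
  rw [intervalIntegral.integral_add (continuous_const.intervalIntegrable _ _)
    ((hdc' _).intervalIntegrable _ _), intervalIntegral.integral_const,
    intervalIntegral.integral_const_mul, smul_eq_mul, ← hl] at hmono
  have e : l * (1 / (8 * l)) = 1 / 8 := by
    field_simp
  rw [div_le_iff₀ (by positivity)]
  rw [e] at hmono
  nlinarith

theorem lintegral_normSq_deriv_le {g : ℂ → ℂ} {U : Set ℂ} (hU : IsOpen U)
    (hg : DifferentiableOn ℂ g U) (hi : InjOn g U) :
    ∫⁻ z in U, ENNReal.ofReal (‖deriv g z‖ ^ 2 / (1 + ‖g z‖ ^ 2) ^ 2) ≤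
      ∫⁻ w : ℂ, ENNReal.ofReal (1 / (1 + ‖w‖ ^ 2) ^ 2) := by
  have h := lintegral_image_eq_lintegral_abs_det_fderiv_mul volume hU.measurableSet
    (f' := fun z => (ContinuousLinearMap.toSpanSingleton ℂ (deriv g z) :
      ℂ →L[ℂ] ℂ).restrictScalars ℝ)
    (fun z hz => ((hg.differentiableAt (hU.mem_nhds hz)).hasDerivAt.hasFDerivAt.restrictScalars
      ℝ).hasFDerivWithinAt) hi (fun w => ENNReal.ofReal (1 / (1 + ‖w‖ ^ 2) ^ 2))
  refine le_trans (le_of_eq ?_) (setLIntegral_le_lintegral (g '' U) _)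
  rw [h]
  refine lintegral_congr fun z => ?_
  rw [← ENNReal.ofReal_mul (abs_nonneg _)]
  congr 1
  have hdet : ((ContinuousLinearMap.toSpanSingleton ℂ (deriv g z) : ℂ →L[ℂ] ℂ).restrictScalars
      ℝ).det = ‖deriv g z‖ ^ 2 := by
    rw [ContinuousLinearMap.det, ContinuousLinearMap.coe_restrictScalars,
      LinearMap.det_restrictScalars, Algebra.norm_complex_apply, Complex.normSq_eq_norm_sq]
    simp [LinearMap.det_ring]
  rw [hdet, abs_of_nonneg (by positivity)]
  ring

theorem lintegral_one_add_normSq_lt_top :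
    ∫⁻ w : ℂ, ENNReal.ofReal (1 / (1 + ‖w‖ ^ 2) ^ 2) < ⊤ := by
  have h := (integrable_rpow_neg_one_add_norm_sq (E := ℂ) (μ := volume) (r := 4)
    (by rw [Complex.finrank_real_complex]; norm_num)).lintegral_lt_top
  refine lt_of_le_of_lt (le_of_eq (lintegral_congr fun w => ?_)) h
  congr 1
  rw [show (-4 / 2 : ℝ) = -(2 : ℕ) by norm_num, Real.rpow_neg (by positivity), Real.rpow_natCast,
    one_div]

theorem sub_mul_le_lintegral_reProdIm {G : ℂ → ℝ} {a b p q c : ℝ} (hpq : p ≤ q)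
    (hc : 0 ≤ c)
    (hG : ContinuousOn G {z | z.re < b}) (hG0 : ∀ z, 0 ≤ G z)
    (hle : ∀ s ∈ Ioo a b, c ≤ ∫ t in p..q, G ⟨s, t⟩) :
    ENNReal.ofReal (c * (b - a)) ≤ ∫⁻ z in Ioo a b ×ℂ Ioo p q, ENNReal.ofReal (G z) := by
  have hmp := Complex.volume_preserving_equiv_real_prod.symm
  rw [← hmp.setLIntegral_comp_preimage_emb Complex.measurableEquivRealProd.symm.measurableEmbedding]
  have hpre : (Complex.measurableEquivRealProd.symm : ℝ × ℝ → ℂ) ⁻¹' (Ioo a b ×ℂ Ioo p q) =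
      Ioo a b ×ˢ Ioo p q := by
    ext x
    simp [Complex.mem_reProdIm, Complex.measurableEquivRealProd_symm_apply]
  have hmk : Continuous fun x : ℝ × ℝ => (⟨x.1, x.2⟩ : ℂ) :=
    Complex.equivRealProdCLM.symm.continuous
  rw [hpre, Measure.volume_eq_prod, setLIntegral_prod]
  · calc ENNReal.ofReal (c * (b - a)) = ∫⁻ _ in Ioo a b, ENNReal.ofReal c := by
          rw [setLIntegral_const, Real.volume_Ioo, ENNReal.ofReal_mul hc]
      _ ≤ _ := setLIntegral_mono' measurableSet_Ioo fun s hs => ?_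
    simp only [Complex.measurableEquivRealProd_symm_apply]
    have hcont : Continuous fun t : ℝ => G ⟨s, t⟩ := by
      refine hG.comp_continuous (hmk.comp (Continuous.prodMk_right s)) fun t => hs.2
    rw [← ofReal_integral_eq_lintegral_ofReal
      (hcont.integrableOn_Icc.mono_set Ioo_subset_Icc_self) (ae_of_all _ fun t => hG0 _)]
    refine ENNReal.ofReal_le_ofReal ?_
    rw [← integral_Ioc_eq_integral_Ioo, ← intervalIntegral.integral_of_le hpq]
    exact hle s hs
  · simp only [Complex.measurableEquivRealProd_symm_apply]
    refine ENNReal.measurable_ofReal.comp_aemeasurable ?_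
    refine ContinuousOn.aemeasurable ?_ (measurableSet_Ioo.prod measurableSet_Ioo)
    exact hG.comp hmk.continuousOn fun x hx => hx.1.2

theorem exists_norm_le_two_of_injOn_ball : ∃ r : ℝ, 0 < r ∧ r < 1 ∧ ∀ f : ℂ → ℂ,
    DifferentiableOn ℂ f (Metric.ball 0 1) → InjOn f (Metric.ball 0 1) → f 0 = 0 →
    deriv f 0 = 1 → ∀ z ∈ Metric.closedBall (0 : ℂ) r, ‖f z‖ ≤ 2 := by
  set K := ∫⁻ w : ℂ, ENNReal.ofReal (1 / (1 + ‖w‖ ^ 2) ^ 2)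
  have hK : K ≠ ⊤ := lintegral_one_add_normSq_lt_top.ne
  set c : ℝ := 1 / (16 * (Real.pi - -Real.pi)) with hc
  have hpi := Real.pi_pos
  have hc0 : 0 < c := by
    have : 0 < Real.pi - -Real.pi := by linarith
    positivity
  set S := K.toReal / c + 1 with hS
  have hS0 : 0 < S := by positivity
  refine ⟨Real.exp (-S), Real.exp_pos _, Real.exp_lt_one_iff.2 (by linarith), ?_⟩
  intro f hf hi h0 h1
  by_contra! hcon
  obtain ⟨z₀, hz₀, hz₀2⟩ := hcon
  have hexp : MapsTo Complex.exp {z : ℂ | z.re < 0} (Metric.ball 0 1) := by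
    intro z hz
    rw [mem_ball_zero_iff, Complex.norm_exp]
    exact Real.exp_lt_one_iff.2 hz
  have hopen : IsOpen {z : ℂ | z.re < 0} := isOpen_lt Complex.continuous_re continuous_const
  have hsubset : Ioo (-S) 0 ×ℂ Ioo (-Real.pi) Real.pi ⊆ {z : ℂ | z.re < 0} := fun z hz => hz.1.2
  set g : ℂ → ℂ := fun z => f (Complex.exp z) with hg
  have hgd : DifferentiableOn ℂ g {z : ℂ | z.re < 0} :=
    hf.comp Complex.differentiable_exp.differentiableOn hexp
  have hgi : InjOn g (Ioo (-S) 0 ×ℂ Ioo (-Real.pi) Real.pi) := by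
    intro z hz w hw h
    exact Complex.exp_inj_of_neg_pi_lt_of_le_pi hz.2.1 hz.2.2.le hw.2.1 hw.2.2.le
      (hi (hexp (hsubset hz)) (hexp (hsubset hw)) h)
  have hg'c : ContinuousOn (deriv g) {z : ℂ | z.re < 0} := (hgd.deriv hopen).continuousOn
  have hup := lintegral_normSq_deriv_le (isOpen_Ioo.reProdIm isOpen_Ioo) (hgd.mono hsubset) hgi
  have hlow := sub_mul_le_lintegral_reProdIm (a := -S) (b := 0) (p := -Real.pi) (q := Real.pi)
    (G := fun z => ‖deriv g z‖ ^ 2 / (1 + ‖g z‖ ^ 2) ^ 2) (c := c) (by linarith)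
    hc0.le ((hg'c.norm.pow 2).div ((continuousOn_const.add (hgd.continuousOn.norm.pow 2)).pow 2)
      fun z _ => (by positivity : (0 : ℝ) < (1 + ‖g z‖ ^ 2) ^ 2).ne') (fun z => by positivity) (by
    intro s hs
    have hr1 : Real.exp s < 1 := Real.exp_lt_one_iff.2 hs.2
    have hpolar : ∀ z ∈ Metric.sphere (0 : ℂ) (Real.exp s), ∃ t ∈ Icc (-Real.pi) Real.pi,
        Complex.exp ⟨s, t⟩ = z := by
      intro z hz
      rw [mem_sphere_zero_iff_norm] at hz
      have hz0 : z ≠ 0 := by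
        rintro rfl
        rw [norm_zero] at hz
        exact (Real.exp_pos s).ne hz
      refine ⟨z.arg, ⟨(Complex.neg_pi_lt_arg z).le, Complex.arg_le_pi z⟩, ?_⟩
      have : (⟨s, z.arg⟩ : ℂ) = Complex.log z := by
        apply Complex.ext
        · rw [Complex.log_re, hz, Real.log_exp]
        · rw [Complex.log_im]
      rw [this, Complex.exp_log hz0]
    obtain ⟨zα, hzα, hα1⟩ := exists_mem_sphere_norm_le_one hf hi h0 h1 (Real.exp_pos s) hr1
    have hβ : ∃ z ∈ Metric.sphere (0 : ℂ) (Real.exp s), 2 ≤ ‖f z‖ := by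
      by_contra! hlt
      have hdc : DiffContOnCl ℂ f (Metric.ball 0 (Real.exp s)) := by
        refine DifferentiableOn.diffContOnCl (hf.mono ?_)
        rw [closure_ball _ (Real.exp_pos s).ne']
        exact Metric.closedBall_subset_ball hr1
      refine absurd (Complex.norm_le_of_forall_mem_frontier_norm_le Metric.isBounded_ball hdc
        (C := 2) (fun z hz => (hlt z ?_).le) (z := z₀) ?_) (not_le.2 hz₀2)
      · rwa [frontier_ball _ (Real.exp_pos s).ne'] at hz
      · rw [closure_ball _ (Real.exp_pos s).ne']
        exact Metric.closedBall_subset_closedBall (Real.exp_le_exp.2 hs.1.le) hz₀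
    obtain ⟨zβ, hzβ, hβ2⟩ := hβ
    obtain ⟨α, hα, rfl⟩ := hpolar zα hzα
    obtain ⟨β, hβ, rfl⟩ := hpolar zβ hzβ
    have hmk : ∀ t : ℝ, HasDerivAt (fun t : ℝ => (⟨s, t⟩ : ℂ)) Complex.I t := by
      intro t
      have h := ((Complex.ofRealCLM.hasDerivAt (x := t)).mul_const Complex.I).const_add (s : ℂ)
      simp only [Complex.ofRealCLM_apply, Complex.ofReal_one, one_mul] at h
      refine h.congr_of_eventuallyEq (Eventually.of_forall fun t => ?_)
      exact Complex.mk_eq_add_mul_I s t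
    have hF : ∀ t : ℝ, HasDerivAt (fun t : ℝ => g ⟨s, t⟩) (deriv g ⟨s, t⟩ * Complex.I) t := by
      intro t
      exact (hgd.differentiableAt (hopen.mem_nhds (show (⟨s, t⟩ : ℂ).re < 0 from
        hs.2))).hasDerivAt.comp t (hmk t)
    have hF' : Continuous fun t : ℝ => deriv g ⟨s, t⟩ * Complex.I :=
      (hg'c.comp_continuous (continuous_iff_continuousAt.2 fun t => (hmk t).continuousAt)
        fun t => hs.2).mul continuous_const
    have := le_integral_normSq_deriv_of_norm_le_one_of_two_le hF hF' (by linarith) hα hβ hα1 hβ2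
    simpa only [norm_mul, Complex.norm_I, mul_one] using this)
  have hfin := ENNReal.toReal_mono hK (hlow.trans hup)
  rw [ENNReal.toReal_ofReal (by nlinarith), sub_neg_eq_add, zero_add, hS, mul_add,
    mul_div_cancel₀ _ hc0.ne'] at hfin
  linarith

theorem isOpen_re_pos : IsOpen {v : ℂ | 0 < v.re} := isOpen_lt continuous_const Complex.continuous_re

theorem exists_norm_deriv_deriv_le_of_injOn : ∃ K : ℝ, 0 < K ∧ ∀ φ : ℂ → ℂ,
    DifferentiableOn ℂ φ {v : ℂ | 0 < v.re} → InjOn φ {v : ℂ | 0 < v.re} →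
    ∀ v : ℂ, 0 < v.re → ‖deriv (deriv φ) v‖ ≤ K / v.re * ‖deriv φ v‖ := by
  obtain ⟨r, hr0, hr1, hr⟩ := exists_norm_le_two_of_injOn_ball
  refine ⟨4 / r ^ 2, by positivity, fun φ hφ hi v hv => ?_⟩
  have hp : deriv φ v ≠ 0 := deriv_ne_zero_of_injOn isOpen_re_pos hφ hi hv
  set x := v.re with hx
  have hxc : (x : ℂ) ≠ 0 := Complex.ofReal_ne_zero.2 hv.ne'
  have hmem : ∀ z ∈ Metric.ball (0 : ℂ) 1, v + x * z ∈ {v : ℂ | 0 < v.re} := by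
    intro z hz
    rw [mem_ball_zero_iff] at hz
    have := (abs_le.1 (Complex.abs_re_le_norm z)).1
    simp only [mem_ofPred_eq, Complex.add_re, Complex.re_ofReal_mul, ← hx]
    nlinarith
  set f : ℂ → ℂ := fun z => (φ (v + x * z) - φ v) / (x * deriv φ v) with hf
  have hlin : ∀ z : ℂ, HasDerivAt (fun z : ℂ => v + x * z) x z := fun z => by
    simpa using ((hasDerivAt_id z).const_mul (x : ℂ)).const_add v
  have hfd : ∀ z ∈ Metric.ball (0 : ℂ) 1, HasDerivAt f (deriv φ (v + x * z) / deriv φ v) z := by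
    intro z hz
    have h := ((((hφ.differentiableAt (isOpen_re_pos.mem_nhds (hmem z hz))).hasDerivAt.comp z
      (hlin z)).sub_const (φ v)).div_const (x * deriv φ v))
    refine h.congr_deriv ?_
    field_simp
  have hfdo : DifferentiableOn ℂ f (Metric.ball 0 1) := fun z hz =>
    (hfd z hz).differentiableAt.differentiableWithinAt
  have hfi : InjOn f (Metric.ball 0 1) := by
    intro z hz w hw h
    have h1 : φ (v + x * z) = φ (v + x * w) := by
      have := (div_left_inj' (mul_ne_zero hxc hp)).1 h
      exact sub_left_injective this
    exact mul_left_cancel₀ hxc (add_left_cancel (hi (hmem z hz) (hmem w hw) h1))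
  have h0 : (0 : ℂ) ∈ Metric.ball (0 : ℂ) 1 := Metric.mem_ball_self one_pos
  have hbd := hr f hfdo hfi (by simp [hf]) (by simpa [hp] using (hfd 0 h0).deriv)
  have hdd : deriv (deriv f) 0 = x * deriv (deriv φ) v / deriv φ v := by
    have he : deriv f =ᶠ[𝓝 0] fun z => deriv φ (v + x * z) / deriv φ v := by
      filter_upwards [Metric.isOpen_ball.mem_nhds h0] with z hz
      exact (hfd z hz).deriv
    rw [he.deriv_eq]
    have h := (((hφ.deriv isOpen_re_pos).differentiableAt (isOpen_re_pos.mem_nhds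
      (hmem 0 h0))).hasDerivAt.comp 0 (hlin 0)).div_const (deriv φ v)
    refine h.deriv.trans ?_
    rw [mul_zero, add_zero, mul_comm]
  have hcauchy := Complex.norm_iteratedDeriv_le_of_forall_mem_sphere_norm_le 2 hr0
    (DifferentiableOn.diffContOnCl (f := f) (s := Metric.ball 0 r) (hfdo.mono (by
      rw [closure_ball _ hr0.ne']
      exact Metric.closedBall_subset_ball hr1)))
    (fun z hz => hbd z (Metric.sphere_subset_closedBall hz))
  rw [iteratedDeriv_succ, iteratedDeriv_one, hdd, norm_div, norm_mul, Complex.norm_real,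
    Real.norm_of_nonneg hv.le, div_le_iff₀ (norm_pos_iff.2 hp)] at hcauchy
  rw [div_mul_eq_mul_div, le_div_iff₀ hv, mul_comm]
  refine hcauchy.trans (le_of_eq ?_)
  norm_num [Nat.factorial]

theorem norm_sub_le_of_norm_deriv_le_mul_norm {q q' : ℝ → ℂ} {k T : ℝ} (hk : 0 ≤ k) (hT : 0 ≤ T)
    (hq : ∀ t ∈ Icc 0 T, HasDerivAt q (q' t) t) (hq' : ∀ t ∈ Icc 0 T, ‖q' t‖ ≤ k * ‖q t‖) :
    ‖q T - q 0‖ ≤ ‖q 0‖ * (Real.exp (k * T) - 1) := by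
  have h := norm_le_gronwallBound_of_norm_deriv_right_le (f := fun t => q t - q 0) (f' := q')
    (δ := 0) (K := k) (ε := k * ‖q 0‖) (a := 0) (b := T)
    (fun t ht => ((hq t ht).sub_const _).continuousAt.continuousWithinAt)
    (fun t ht => ((hq t (Ico_subset_Icc_self ht)).sub_const _).hasDerivWithinAt) (by simp)
    (fun t ht => (hq' t (Ico_subset_Icc_self ht)).trans (by
      rw [← mul_add]
      exact mul_le_mul_of_nonneg_left (norm_le_norm_sub_add _ _) hk)) T ⟨hT, le_rfl⟩
  refine h.trans (le_of_eq ?_)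
  rcases eq_or_lt_of_le hk with rfl | hk
  · simp [gronwallBound_K0]
  · rw [gronwallBound_of_K_ne_0 hk.ne']
    simp only [sub_zero, zero_mul, zero_add]
    rw [mul_div_cancel_left₀ _ hk.ne']

theorem norm_le_of_norm_deriv_le_mul_norm {q q' : ℝ → ℂ} {k T : ℝ} (hk : 0 ≤ k) (hT : 0 ≤ T)
    (hq : ∀ t ∈ Icc 0 T, HasDerivAt q (q' t) t) (hq' : ∀ t ∈ Icc 0 T, ‖q' t‖ ≤ k * ‖q t‖) :
    ‖q T‖ ≤ ‖q 0‖ * Real.exp (k * T) := by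
  have h1 := norm_sub_le_of_norm_deriv_le_mul_norm hk hT hq hq'
  have h2 := norm_le_norm_sub_add (q T) (q 0)
  linarith

theorem norm_sub_le_of_norm_deriv_le_div_re {p : ℂ → ℂ} {K : ℝ} (hK : 0 ≤ K)
    (hp : DifferentiableOn ℂ p {v : ℂ | 0 < v.re})
    (hp' : ∀ v : ℂ, 0 < v.re → ‖deriv p v‖ ≤ K / v.re * ‖p v‖) {v h : ℂ} (hv : 0 < v.re)
    (hh : 0 ≤ h.re) : ‖p (v + h) - p v‖ ≤ ‖p v‖ * (Real.exp (K * ‖h‖ / v.re) - 1) := by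
  have hmem : ∀ t : ℝ, 0 ≤ t → v.re ≤ (v + t * h).re := fun t ht => by
    simp only [Complex.add_re, Complex.re_ofReal_mul]
    nlinarith [mul_nonneg ht hh]
  have hlin : ∀ t : ℝ, HasDerivAt (fun t : ℝ => v + t * h) h t := fun t => by
    simpa using ((Complex.ofRealCLM.hasDerivAt (x := t)).mul_const h).const_add v
  have := norm_sub_le_of_norm_deriv_le_mul_norm (q := fun t : ℝ => p (v + t * h))
    (q' := fun t => deriv p (v + t * h) * h) (k := K * ‖h‖ / v.re) (T := 1) (by positivity)
    zero_le_one
    (fun t ht => (hp.differentiableAt (isOpen_re_pos.mem_nhds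
      (hv.trans_le (hmem t ht.1)))).hasDerivAt.comp t (hlin t))
    (fun t ht => by
      rw [norm_mul]
      have h1 : K / (v + t * h).re ≤ K / v.re := div_le_div_of_nonneg_left hK hv (hmem t ht.1)
      have h2 := (hp' _ (hv.trans_le (hmem t ht.1))).trans
        (mul_le_mul_of_nonneg_right h1 (norm_nonneg _))
      refine (mul_le_mul_of_nonneg_right h2 (norm_nonneg h)).trans (le_of_eq ?_)
      ring)
  simpa using this

theorem abs_log_norm_sub_le_of_norm_deriv_le_div_re {p : ℂ → ℂ} {K : ℝ} (hK : 0 ≤ K)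
    (hp : DifferentiableOn ℂ p {v : ℂ | 0 < v.re})
    (hp' : ∀ v : ℂ, 0 < v.re → ‖deriv p v‖ ≤ K / v.re * ‖p v‖)
    (hp0 : ∀ v : ℂ, 0 < v.re → p v ≠ 0) {x : ℝ} (hx : 1 ≤ x) :
    |Real.log ‖p x‖ - Real.log ‖p 1‖| ≤ K * Real.log x := by
  have hx0 : 0 < x := by linarith
  have hd : ∀ u : ℝ, HasDerivAt (fun t : ℝ => p (Real.exp t : ℝ))
      (deriv p (Real.exp u : ℝ) * (Real.exp u : ℝ)) u := fun u =>
    HasDerivAt.comp u (hp.differentiableAt (isOpen_re_pos.mem_nhds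
      (show 0 < ((Real.exp u : ℝ) : ℂ).re from Real.exp_pos u))).hasDerivAt
      (Real.hasDerivAt_exp u).ofReal_comp
  have hb : ∀ u : ℝ, ‖deriv p (Real.exp u : ℝ) * (Real.exp u : ℝ)‖ ≤
      K * ‖p (Real.exp u : ℝ)‖ := fun u => by
    have := hp' (Real.exp u : ℝ) (Real.exp_pos u)
    rw [Complex.ofReal_re, div_mul_eq_mul_div, le_div_iff₀ (Real.exp_pos u)] at this
    rwa [norm_mul, Complex.norm_real, Real.norm_of_nonneg (Real.exp_pos u).le]
  have hL : 0 ≤ Real.log x := Real.log_nonneg hx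
  have h1 := norm_le_of_norm_deriv_le_mul_norm hK hL (fun t _ => hd t) (fun t _ => hb t)
  have h2 := norm_le_of_norm_deriv_le_mul_norm (q := fun t => p (Real.exp (Real.log x - t) : ℝ))
    hK hL (fun t _ => (hd (Real.log x - t)).comp_const_sub (Real.log x) t)
    (fun t _ => by rw [norm_neg]; exact hb _)
  simp only [Real.exp_log hx0, Real.exp_zero, Complex.ofReal_one, sub_self, sub_zero] at h1 h2
  have hpx := norm_pos_iff.2 (hp0 x hx0)
  have hp1 := norm_pos_iff.2 (hp0 1 one_pos)
  have h1' := Real.log_le_log hpx h1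
  have h2' := Real.log_le_log hp1 h2
  rw [Real.log_mul hp1.ne' (Real.exp_pos _).ne', Real.log_exp] at h1'
  rw [Real.log_mul hpx.ne' (Real.exp_pos _).ne', Real.log_exp] at h2'
  rw [abs_le]
  constructor <;> linarith

theorem norm_add_sub_le_of_norm_deriv_le_div_re {p : ℂ → ℂ} {K : ℝ} (hK : 0 ≤ K)
    (hp : DifferentiableOn ℂ p {v : ℂ | 0 < v.re})
    (hp' : ∀ v : ℂ, 0 < v.re → ‖deriv p v‖ ≤ K / v.re * ‖p v‖) {x s y : ℝ} (hx : 0 < x)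
    (hs : 0 ≤ s) : ‖p (x + s + y * Complex.I) - p x‖ ≤
      ‖p x‖ * (Real.exp (K * |y| / x + K / x * s) - 1) := by
  have h := norm_sub_le_of_norm_deriv_le_div_re hK hp hp' (v := x) (h := s + y * Complex.I)
    (by simpa using hx) (by simpa using hs)
  rw [Complex.ofReal_re, ← add_assoc] at h
  refine h.trans (mul_le_mul_of_nonneg_left (sub_le_sub_right (Real.exp_le_exp.2 ?_) _)
    (norm_nonneg _))
  have hn : ‖(s + y * Complex.I : ℂ)‖ ≤ s + |y| := by
    refine (norm_add_le _ _).trans (le_of_eq ?_)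
    simp [abs_of_nonneg hs]
  calc K * ‖(s + y * Complex.I : ℂ)‖ / x ≤ K * (s + |y|) / x := by gcongr
    _ = _ := by ring

theorem tendsto_add_of_tendsto_real {p ψ : ℂ → ℂ} {K : ℝ} (hK : 0 ≤ K)
    (hp : DifferentiableOn ℂ p {v : ℂ | 0 < v.re})
    (hp' : ∀ v : ℂ, 0 < v.re → ‖deriv p v‖ ≤ K / v.re * ‖p v‖)
    (hψ : ∀ w ∈ {v : ℂ | 0 < v.re}, HasDerivAt ψ (-(Complex.exp (-w)) * p w) w)
    (hψ0 : Tendsto (fun x : ℝ => ψ (x : ℂ)) atTop (𝓝 0)) {x : ℝ} (hx : 0 < x) (hKx : K < x)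
    (y : ℝ) : Tendsto (fun s : ℝ => ψ (x + s + y * Complex.I)) atTop (𝓝 0) := by
  have hb : 0 < 1 - K / x := sub_pos.2 ((div_lt_one hx).2 hKx)
  have hdiff : Tendsto (fun s : ℝ => ψ (x + s + y * Complex.I) - ψ (x + s)) atTop (𝓝 0) := by
    have hlim : Tendsto (fun s : ℝ => Real.exp (-x) * (‖p x‖ * Real.exp (K * |y| / x)) * |y| *
        Real.exp (-((1 - K / x) * s))) atTop (𝓝 0) := by
      rw [← mul_zero (Real.exp (-x) * (‖p x‖ * Real.exp (K * |y| / x)) * |y|)]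
      exact (Real.tendsto_exp_neg_atTop_nhds_zero.comp
        (tendsto_id.const_mul_atTop hb)).const_mul _
    refine squeeze_zero_norm' ?_ hlim
    filter_upwards [eventually_ge_atTop 0] with s hs
    have hseg : ∀ z ∈ segment ℝ (x + s : ℂ) (x + s + y * Complex.I),
        ∃ y' : ℝ, |y'| ≤ |y| ∧ z = x + s + y' * Complex.I := by
      intro z hz
      rw [segment_eq_image'] at hz
      obtain ⟨t, ht, rfl⟩ := hz
      refine ⟨t * y, ?_, ?_⟩
      · rw [abs_mul, abs_of_nonneg ht.1]
        exact mul_le_of_le_one_left (abs_nonneg y) ht.2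
      · simp [mul_assoc]
    have hre : ∀ y' : ℝ, (x + s + y' * Complex.I : ℂ).re = x + s := fun y' => by simp
    have h := (convex_segment (𝕜 := ℝ) (x + s : ℂ)
      (x + s + y * Complex.I)).norm_image_sub_le_of_norm_hasDerivWithin_le (f := ψ)
      (f' := fun w => -(Complex.exp (-w)) * p w)
      (C := Real.exp (-(x + s)) * (‖p x‖ * Real.exp (K * |y| / x + K / x * s)))
      (fun z hz => by
        obtain ⟨y', -, rfl⟩ := hseg z hz
        refine (hψ _ ?_).hasDerivWithinAt
        rw [mem_ofPred_eq, hre]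
        positivity)
      (fun z hz => by
        obtain ⟨y', hy', rfl⟩ := hseg z hz
        rw [norm_mul, norm_neg, Complex.norm_exp, Complex.neg_re, hre]
        refine mul_le_mul_of_nonneg_left ?_ (Real.exp_pos _).le
        have h1 := norm_add_sub_le_of_norm_deriv_le_div_re hK hp hp' (y := y') hx hs
        have h2 := norm_le_norm_sub_add (p (x + s + y' * Complex.I)) (p x)
        have h3 : ‖p (x + s + y' * Complex.I)‖ ≤ ‖p x‖ * Real.exp (K * |y'| / x + K / x * s) := by
          linarith
        refine h3.trans ?_
        gcongr)
      (left_mem_segment ℝ _ _) (right_mem_segment ℝ _ _)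
    refine h.trans (le_of_eq ?_)
    have e1 : ‖(x + s + y * Complex.I - (x + s) : ℂ)‖ = |y| := by simp
    have e2 : Real.exp (-(x + s)) * Real.exp (K * |y| / x + K / x * s) =
        Real.exp (-x) * Real.exp (K * |y| / x) * Real.exp (-((1 - K / x) * s)) := by
      rw [← Real.exp_add, ← Real.exp_add, ← Real.exp_add]
      congr 1
      ring
    rw [e1]
    linear_combination ‖p x‖ * |y| * e2
  have hreal : Tendsto (fun s : ℝ => ψ (x + s)) atTop (𝓝 0) := by
    have := hψ0.comp (tendsto_const_nhds (x := x) |>.add_atTop tendsto_id)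
    refine this.congr fun s => ?_
    simp
  simpa using hdiff.add hreal

theorem norm_sub_exp_neg_mul_le {p ψ : ℂ → ℂ} {K : ℝ} (hK : 0 ≤ K)
    (hp : DifferentiableOn ℂ p {v : ℂ | 0 < v.re})
    (hp' : ∀ v : ℂ, 0 < v.re → ‖deriv p v‖ ≤ K / v.re * ‖p v‖)
    (hψ : ∀ w ∈ {v : ℂ | 0 < v.re}, HasDerivAt ψ (-(Complex.exp (-w)) * p w) w)
    (hψ0 : Tendsto (fun x : ℝ => ψ (x : ℂ)) atTop (𝓝 0)) {w : ℂ} (hw : 0 < w.re)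
    (hKw : K < w.re) : ‖ψ w - Complex.exp (-w) * p w.re‖ ≤
      Real.exp (-w.re) * ‖p w.re‖ *
        (Real.exp (K * |w.im| / w.re) / (1 - K / w.re) - 1) := by
  set x := w.re with hx
  set y := w.im with hy
  set b := 1 - K / x with hbdef
  have hb : 0 < b := sub_pos.2 ((div_lt_one hw).2 hKw)
  set a := K * |y| / x
  set c := Real.exp (-x) * ‖p x‖
  set γ : ℝ → ℂ := fun s => x + s + y * Complex.I with hγ
  have hγre : ∀ s, (γ s).re = x + s := fun s => by simp [hγ]
  have hγd : ∀ s, HasDerivAt γ 1 s := fun s => by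
    simpa [hγ] using ((Complex.ofRealCLM.hasDerivAt (x := s)).const_add (x : ℂ)).add_const
      (y * Complex.I)
  have hγ0 : γ 0 = w := by
    simp only [hγ, Complex.ofReal_zero, add_zero, hx, hy, Complex.re_add_im]
  set G : ℝ → ℂ := fun s => ψ (γ s) - Complex.exp (-γ s) * p x with hG
  have hGd : ∀ s, 0 ≤ s → HasDerivAt G (-Complex.exp (-γ s) * (p (γ s) - p x)) s := by
    intro s hs
    have h1 := (hψ (γ s) (by rw [mem_ofPred_eq, hγre]; positivity)).comp s (hγd s)
    have h2 := ((hγd s).neg.cexp).mul_const (p x)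
    refine (h1.sub h2).congr_deriv ?_
    simp only [Pi.neg_apply]
    ring
  set B : ℝ → ℝ := fun s => c * (Real.exp a / b * (1 - Real.exp (-(b * s))) -
    (1 - Real.exp (-s))) with hB
  have hBd : ∀ s, HasDerivAt B (c * (Real.exp a * Real.exp (-(b * s)) - Real.exp (-s))) s := by
    intro s
    have h1 := ((((hasDerivAt_id s).const_mul b).neg.exp).const_sub 1).const_mul (Real.exp a / b)
    have h2 := (((hasDerivAt_id s).neg.exp).const_sub 1)
    refine ((h1.sub h2).const_mul c).congr_deriv ?_
    simp only [id, Pi.neg_apply]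
    field_simp
  have hbound : ∀ S, 0 ≤ S → ‖G S - G 0‖ ≤ B S := by
    intro S hS
    refine image_norm_le_of_norm_deriv_right_le_deriv_boundary (f := fun s => G s - G 0)
      (a := 0) (b := S) (fun s hs => ((hGd s hs.1).sub_const _).continuousAt.continuousWithinAt)
      (fun s hs => ((hGd s hs.1).sub_const _).hasDerivWithinAt) (by simp [hB]) hBd
      (fun s hs => ?_) ⟨hS, le_rfl⟩
    rw [norm_mul, norm_neg, Complex.norm_exp, Complex.neg_re, hγre]
    have h1 := norm_add_sub_le_of_norm_deriv_le_div_re hK hp hp' (y := y) hw hs.1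
    refine (mul_le_mul_of_nonneg_left h1 (Real.exp_pos _).le).trans (le_of_eq ?_)
    have e1 : Real.exp (-(x + s)) * Real.exp (K * |y| / x + K / x * s) =
        Real.exp (-x) * (Real.exp a * Real.exp (-(b * s))) := by
      rw [← Real.exp_add, ← Real.exp_add, ← Real.exp_add]
      congr 1
      ring
    have e2 : Real.exp (-(x + s)) = Real.exp (-x) * Real.exp (-s) := by
      rw [← Real.exp_add]
      congr 1
      ring
    linear_combination ‖p x‖ * e1 - ‖p x‖ * e2
  have hexp0 : Tendsto (fun s : ℝ => Real.exp (-s)) atTop (𝓝 0) :=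
    Real.tendsto_exp_neg_atTop_nhds_zero
  have hexpb : Tendsto (fun s : ℝ => Real.exp (-(b * s))) atTop (𝓝 0) :=
    hexp0.comp (tendsto_id.const_mul_atTop hb)
  have hBlim : Tendsto B atTop (𝓝 (c * (Real.exp a / b - 1))) := by
    have := (((hexpb.const_sub 1).const_mul (Real.exp a / b)).sub (hexp0.const_sub 1)).const_mul c
    simpa [hB] using this
  have hGlim : Tendsto G atTop (𝓝 0) := by
    have h1 := tendsto_add_of_tendsto_real hK hp hp' hψ hψ0 hw hKw y
    have h2 : Tendsto (fun s => Complex.exp (-γ s)) atTop (𝓝 0) := by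
      rw [tendsto_zero_iff_norm_tendsto_zero]
      simp only [Complex.norm_exp, Complex.neg_re, hγre]
      exact hexp0.comp (tendsto_const_nhds.add_atTop tendsto_id)
    simpa using h1.sub (h2.mul_const (p x))
  have hfin := le_of_tendsto_of_tendsto (hGlim.sub_const (G 0)).norm hBlim
    ((eventually_ge_atTop 0).mono hbound)
  rw [zero_sub, norm_neg] at hfin
  simpa only [hG, hγ0] using hfin

/-- Let `φ` be holomorphic and univalent on `H = {Re v > 0}` and let
`ψ(w) = ∫_w^∞ e^{-t} φ'(t) dt` (i.e. `ψ' = -e^{-w} φ'(w)` on `H` and `ψ(x) → 0` as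
`x → +∞` along the reals). Then `ψ(w) ~ e^{-w} φ'(Re w)` as `w → ∞` in the region
`H₁ = {x + iy : x > N₁, |y| < √x}`, and `λ(w) = -log ψ(w) = w + O(log |w|)` there. -/
theorem stmt12 (φ ψ : ℂ → ℂ)
    (hφd : DifferentiableOn ℂ φ {v : ℂ | 0 < v.re})
    (hφi : Set.InjOn φ {v : ℂ | 0 < v.re})
    (hψ : ∀ w ∈ {v : ℂ | 0 < v.re}, HasDerivAt ψ (-(Complex.exp (-w)) * deriv φ w) w)
    (hψ0 : Filter.Tendsto (fun x : ℝ => ψ (x : ℂ)) Filter.atTop (nhds 0)) :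
    (∀ ε : ℝ, 0 < ε → ∃ N₁ : ℝ, ∀ w : ℂ, N₁ < w.re → |w.im| < Real.sqrt w.re →
      ‖ψ w / (Complex.exp (-w) * deriv φ ((w.re : ℝ) : ℂ)) - 1‖ < ε) ∧
    (∃ C N₁ : ℝ, 0 < C ∧ ∀ w : ℂ, N₁ < w.re → |w.im| < Real.sqrt w.re →
      ∃ l : ℂ, Complex.exp (-l) = ψ w ∧ ‖l - w‖ ≤ C * Real.log ‖w‖) := by
  obtain ⟨K, hK, hKφ⟩ := exists_norm_deriv_deriv_le_of_injOn
  have hp' := hKφ φ hφd hφi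
  have hp := hφd.deriv isOpen_re_pos
  have hp0 : ∀ v : ℂ, 0 < v.re → deriv φ v ≠ 0 := fun v hv =>
    deriv_ne_zero_of_injOn isOpen_re_pos hφd hφi hv
  have hasymp : ∀ ε : ℝ, 0 < ε → ∃ N₁ : ℝ, ∀ w : ℂ, N₁ < w.re → |w.im| < Real.sqrt w.re →
      ‖ψ w / (Complex.exp (-w) * deriv φ ((w.re : ℝ) : ℂ)) - 1‖ < ε := by
    intro ε hε
    have hlim : Tendsto (fun x : ℝ => Real.exp (K / Real.sqrt x) / (1 - K / x) - 1) atTop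
        (𝓝 0) := by
      have h1 : Tendsto (fun x : ℝ => K / Real.sqrt x) atTop (𝓝 0) :=
        Real.tendsto_sqrt_atTop.const_div_atTop K
      have h2 : Tendsto (fun x : ℝ => K / x) atTop (𝓝 0) := tendsto_id.const_div_atTop K
      have h3 := ((Real.continuous_exp.tendsto 0).comp h1).div (h2.const_sub 1) (by norm_num)
      simpa using h3.sub_const 1
    obtain ⟨N, hN⟩ := eventually_atTop.1 (hlim.eventually_lt_const hε)
    refine ⟨max N K, fun w hw hwi => ?_⟩
    have hwK : K < w.re := (le_max_right _ _).trans_lt hw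
    have hw0 : 0 < w.re := hK.trans hwK
    have hden : Complex.exp (-w) * deriv φ (w.re : ℂ) ≠ 0 :=
      mul_ne_zero (Complex.exp_ne_zero _) (hp0 _ hw0)
    have hmain := norm_sub_exp_neg_mul_le hK.le hp hp' hψ hψ0 hw0 hwK
    rw [div_sub_one hden, norm_div, div_lt_iff₀ (norm_pos_iff.2 hden), norm_mul,
      Complex.norm_exp, Complex.neg_re, mul_comm ε]
    refine hmain.trans_lt (mul_lt_mul_of_pos_left (lt_of_le_of_lt ?_
      (hN w.re ((le_max_left _ _).trans hw.le)))
      (mul_pos (Real.exp_pos _) (norm_pos_iff.2 (hp0 _ hw0))))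
    have hb : 0 < 1 - K / w.re := sub_pos.2 ((div_lt_one hw0).2 hwK)
    have hexp : K * |w.im| / w.re ≤ K / Real.sqrt w.re := by
      have hsq := Real.sqrt_pos.2 hw0
      rw [div_le_div_iff₀ hw0 hsq]
      nlinarith [Real.mul_self_sqrt hw0.le, mul_pos hK hsq]
    gcongr
  refine ⟨hasymp, ?_⟩
  obtain ⟨N, hN⟩ := hasymp (1 / 2) one_half_pos
  refine ⟨Real.log 2 + |Real.log ‖deriv φ 1‖| + Real.pi + K, max N (Real.exp 1),
    by positivity, fun w hw hwi => ?_⟩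
  have hwe : Real.exp 1 < w.re := (le_max_right _ _).trans_lt hw
  have hw1 : 1 ≤ w.re := (Real.one_le_exp zero_le_one).trans hwe.le
  have hw0 : 0 < w.re := by linarith
  have hR := hN w ((le_max_left _ _).trans_lt hw) hwi
  set p := deriv φ (w.re : ℂ) with hpdef
  have hpw : p ≠ 0 := hp0 _ hw0
  set R := ψ w / (Complex.exp (-w) * p) with hRdef
  have hRψ : ψ w * Complex.exp w = R * p := by
    rw [hRdef, Complex.exp_neg]
    field_simp
  have hRlow : 1 / 2 ≤ ‖R‖ := by
    have := norm_sub_norm_le (1 : ℂ) R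
    rw [norm_one, norm_sub_rev] at this
    linarith
  have hRup : ‖R‖ ≤ 2 := by
    have := norm_sub_norm_le R 1
    rw [norm_one] at this
    linarith
  have hR0 : 0 < ‖R‖ := by linarith
  have hz : ψ w * Complex.exp w ≠ 0 := hRψ ▸ mul_ne_zero (norm_pos_iff.1 hR0) hpw
  refine ⟨w - Complex.log (ψ w * Complex.exp w), ?_, ?_⟩
  · rw [neg_sub, Complex.exp_sub, Complex.exp_log hz, mul_div_cancel_right₀ _
      (Complex.exp_ne_zero w)]
  · rw [sub_sub_cancel_left, norm_neg]
    have h1 : ‖Complex.log (ψ w * Complex.exp w)‖ ≤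
        |Real.log ‖ψ w * Complex.exp w‖| + Real.pi := by
      refine (Complex.norm_le_abs_re_add_abs_im _).trans ?_
      rw [Complex.log_re, Complex.log_im]
      gcongr
      exact Complex.abs_arg_le_pi _
    have h2 : |Real.log ‖R‖| ≤ Real.log 2 := by
      rw [abs_le, ← Real.log_inv]
      exact ⟨Real.log_le_log (by norm_num) (by linarith), Real.log_le_log hR0 hRup⟩
    have h3 := abs_log_norm_sub_le_of_norm_deriv_le_div_re hK.le hp hp' hp0 hw1
    have h4 : Real.log w.re ≤ Real.log ‖w‖ :=
      Real.log_le_log hw0 ((le_abs_self _).trans (Complex.abs_re_le_norm w))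
    have h5 : 1 ≤ Real.log w.re := (Real.le_log_iff_exp_le hw0).2 hwe.le
    rw [hRψ, norm_mul, Real.log_mul hR0.ne' (norm_pos_iff.2 hpw).ne'] at h1
    have h6 := abs_add_le (Real.log ‖R‖) (Real.log ‖p‖)
    have h7 := abs_sub_abs_le_abs_sub (Real.log ‖p‖) (Real.log ‖deriv φ 1‖)
    have h8 : K * Real.log w.re ≤ K * Real.log ‖w‖ := mul_le_mul_of_nonneg_left h4 hK.le
    have h9 : 0 ≤ Real.log 2 + |Real.log ‖deriv φ 1‖| + Real.pi := by positivity
    rw [hRψ]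
    nlinarith [mul_le_mul_of_nonneg_left (h5.trans h4) h9]
end
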